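/- arXiv:1210.7375 — 10 statements merged into one kernel-verified Lean document; each statement's English description precedes it below -/
import Mathlib

section
/- Let f ∈ (0,1). Define meeting probabilities π_L(same) = f² + (1−f)², π_L(diff) = 1 − π_L(same), π_T(same) = f³ + (1−f)³, π_T(diff) = 1 − π_T(same). Let p_L(same), p_L(diff), p_T(same), p_T(diff) be strictly positive reals (consent probabilities), and define formation probabilities P_L(x) = p_L(x)²·π_L(x) and P_T(x) = p_T(x)³·π_T(x) for x ∈ {same, diff}. If P_T(diff)/P_T(same) < (P_L(diff)/P_L(same))^{3/2}, then p_T(diff)/p_T(same) < p_L(diff)/p_L(same). -/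
/-- In the biased meeting model with meeting probabilities
`π_L(same) = f² + (1−f)²`, `π_L(diff) = 1 − π_L(same)`, `π_T(same) = f³ + (1−f)³`,
`π_T(diff) = 1 − π_T(same)`, consent probabilities `p_L(·) > 0`, `p_T(·) > 0`, and
formation probabilities `P_L(x) = p_L(x)²·π_L(x)`, `P_T(x) = p_T(x)³·π_T(x)`:
if `P_T(diff)/P_T(same) < (P_L(diff)/P_L(same))^{3/2}` then
`p_T(diff)/p_T(same) < p_L(diff)/p_L(same)`. -/
theorem stmt_0 (f pLs pLd pTs pTd : ℝ)
    (hf0 : 0 < f) (hf1 : f < 1)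
    (hpLs : 0 < pLs) (hpLd : 0 < pLd) (hpTs : 0 < pTs) (hpTd : 0 < pTd)
    (PLs PLd PTs PTd : ℝ)
    (hPLs : PLs = pLs ^ 2 * (f ^ 2 + (1 - f) ^ 2))
    (hPLd : PLd = pLd ^ 2 * (1 - (f ^ 2 + (1 - f) ^ 2)))
    (hPTs : PTs = pTs ^ 3 * (f ^ 3 + (1 - f) ^ 3))
    (hPTd : PTd = pTd ^ 3 * (1 - (f ^ 3 + (1 - f) ^ 3)))
    (h : PTd / PTs < (PLd / PLs) ^ ((3 : ℝ) / 2)) :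
    pTd / pTs < pLd / pLs := by
  have hq : 0 < f * (1 - f) := mul_pos hf0 (by linarith)
  have hq4 : f * (1 - f) ≤ 1 / 4 := by nlinarith [sq_nonneg (2 * f - 1)]
  have hL : f ^ 2 + (1 - f) ^ 2 = 1 - 2 * (f * (1 - f)) := by ring
  have hT : f ^ 3 + (1 - f) ^ 3 = 1 - 3 * (f * (1 - f)) := by ring
  rw [hL] at hPLs hPLd
  rw [hT] at hPTs hPTd
  generalize f * (1 - f) = q at *
  obtain ⟨a, ha⟩ : ∃ a, a = 2 * q / (1 - 2 * q) := ⟨_, rfl⟩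
  obtain ⟨b, hb⟩ : ∃ b, b = 3 * q / (1 - 3 * q) := ⟨_, rfl⟩
  have h2 : 0 < 1 - 2 * q := by linarith
  have h3 : 0 < 1 - 3 * q := by linarith
  have ha0 : 0 < a := by rw [ha]; positivity
  have hb0 : 0 < b := by rw [hb]; positivity
  have ha1 : a ≤ 1 := by rw [ha, div_le_one h2]; linarith
  have hab : a ≤ b := by
    rw [ha, hb, div_le_div_iff₀ h2 h3]
    nlinarith
  have hLratio : PLd / PLs = (pLd / pLs) ^ 2 * a := by
    rw [hPLd, hPLs, ha, sub_sub_cancel, mul_div_mul_comm, div_pow]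
  have hTratio : PTd / PTs = (pTd / pTs) ^ 3 * b := by
    rw [hPTd, hPTs, hb, sub_sub_cancel, mul_div_mul_comm, div_pow]
  have hs : 0 < pLd / pLs := div_pos hpLd hpLs
  have hpow : ((pLd / pLs) ^ 2) ^ ((3 : ℝ) / 2) = (pLd / pLs) ^ 3 := by
    rw [← Real.rpow_natCast_mul hs.le, ← Real.rpow_natCast]
    norm_num
  have hab' : a ^ ((3 : ℝ) / 2) ≤ b :=
    (Real.rpow_le_self_of_le_one ha0.le ha1 (by norm_num)).trans hab
  rw [hLratio, hTratio, Real.mul_rpow (by positivity) ha0.le, hpow] at h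
  have hlt : (pTd / pTs) ^ 3 * b < (pLd / pLs) ^ 3 * b :=
    h.trans_le (mul_le_mul_of_nonneg_left hab' (by positivity))
  exact lt_of_pow_lt_pow_left₀ 3 hs.le (lt_of_mul_lt_mul_right hlt hb0.le)
end

section
/- Let 𝒮 ⊆ ℝ^k be finite and nonempty, K : 𝒮 → (0,∞), and for β ∈ ℝ^k let P_β be the SERGM pmf with weights K. Fix ε ∈ (0,1) and a set B ⊆ ℝ^k of parameters, and for each β ∈ B a subset A_β ⊆ 𝒮 with P_β(A_β) ≥ 1 − ε. For each s ∈ 𝒮 let A_s = ⋃ { A_{β'} : β' ∈ B and s ∈ A_{β'} }, and define the truncated pmf P̄_β(s) = K(s)·exp(⟨β,s⟩) / Σ_{s'∈A_s} K(s')·exp(⟨β,s'⟩). Then for every β ∈ B and every s ∈ A_β: P_β(s) ≤ P̄_β(s) ≤ P_β(s)/(1−ε). -/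
open scoped Classical

/-- Truncating the denominator of a SERGM to the union
`A_s = ⋃ {A_β' : β' ∈ B, s ∈ A_β'}` of high-probability sets changes the pmf by a
factor of at most `1/(1−ε)`: for every `β ∈ B` and `s ∈ A_β`,
`P_β(s) ≤ P̄_β(s) ≤ P_β(s)/(1−ε)`. -/
theorem stmt_2 (k : ℕ) (𝒮 : Finset (Fin k → ℝ)) (h𝒮 : 𝒮.Nonempty)
    (K : (Fin k → ℝ) → ℝ) (hK : ∀ s ∈ 𝒮, 0 < K s)
    (P : (Fin k → ℝ) → (Fin k → ℝ) → ℝ)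
    (hP : ∀ β s, P β s =
      K s * Real.exp (∑ i, β i * s i) /
        ∑ s' ∈ 𝒮, K s' * Real.exp (∑ i, β i * s' i))
    (ε : ℝ) (hε0 : 0 < ε) (hε1 : ε < 1)
    (B : Set (Fin k → ℝ)) (A : (Fin k → ℝ) → Finset (Fin k → ℝ))
    (hA𝒮 : ∀ β ∈ B, A β ⊆ 𝒮)
    (hcov : ∀ β ∈ B, 1 - ε ≤ ∑ s ∈ A β, P β s) :
    ∀ β ∈ B, ∀ s ∈ A β,
      P β s ≤
        K s * Real.exp (∑ i, β i * s i) /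
          ∑ s' ∈ 𝒮.filter (fun s' => ∃ β' ∈ B, s ∈ A β' ∧ s' ∈ A β'),
            K s' * Real.exp (∑ i, β i * s' i) ∧
      K s * Real.exp (∑ i, β i * s i) /
          ∑ s' ∈ 𝒮.filter (fun s' => ∃ β' ∈ B, s ∈ A β' ∧ s' ∈ A β'),
            K s' * Real.exp (∑ i, β i * s' i) ≤ P β s / (1 - ε) := by
  intro β hβ s hs
  set w : (Fin k → ℝ) → ℝ := fun s' => K s' * Real.exp (∑ i, β i * s' i) with hw
  have hwpos : ∀ s' ∈ 𝒮, 0 < w s' := fun s' h => mul_pos (hK s' h) (Real.exp_pos _)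
  have hPw : ∀ s', P β s' = w s' / ∑ s' ∈ 𝒮, w s' := fun s' => hP β s'
  set F := 𝒮.filter (fun s' => ∃ β' ∈ B, s ∈ A β' ∧ s' ∈ A β') with hF
  have hAF : A β ⊆ F := fun x hx =>
    Finset.mem_filter.2 ⟨hA𝒮 β hβ hx, β, hβ, hs, hx⟩
  have hF𝒮 : F ⊆ 𝒮 := Finset.filter_subset _ _
  have hws : 0 < w s := hwpos s (hA𝒮 β hβ hs)
  have hZ : 0 < ∑ s' ∈ 𝒮, w s' := Finset.sum_pos hwpos h𝒮
  have hT : 0 < ∑ s' ∈ F, w s' :=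
    Finset.sum_pos (fun x hx => hwpos x (hF𝒮 hx)) ⟨s, hAF hs⟩
  have hTZ : ∑ s' ∈ F, w s' ≤ ∑ s' ∈ 𝒮, w s' :=
    Finset.sum_le_sum_of_subset_of_nonneg hF𝒮 fun x hx _ => (hwpos x hx).le
  have hAT : ∑ s' ∈ A β, w s' ≤ ∑ s' ∈ F, w s' :=
    Finset.sum_le_sum_of_subset_of_nonneg hAF fun x hx _ => (hwpos x (hF𝒮 hx)).le
  have hmass : (1 - ε) * ∑ s' ∈ 𝒮, w s' ≤ ∑ s' ∈ A β, w s' := by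
    have h := hcov β hβ
    simp only [hPw] at h
    rwa [← Finset.sum_div, le_div_iff₀ hZ] at h
  have hε : 0 < 1 - ε := sub_pos.2 hε1
  rw [hPw s]
  change w s / _ ≤ w s / ∑ s' ∈ F, w s' ∧ w s / ∑ s' ∈ F, w s' ≤ _
  refine ⟨div_le_div_of_nonneg_left hws.le hT hTZ, ?_⟩
  rw [div_div, mul_comm]
  exact div_le_div_of_nonneg_left hws.le (mul_pos hε hZ) (hmass.trans hAT)
end

section
/- Consider a count SERGM with caps S̄ ∈ ℕ^k (each S̄_ℓ ≥ 1), domain A ⊆ ∏_{ℓ=1}^k {0,1,…,S̄_ℓ}, and parameter β ∈ ℝ^k. Let B = ∏_{ℓ=1}^k B_ℓ with each B_ℓ ⊆ {0,…,S̄_ℓ} nonempty and B ⊆ A. Then the conditional distribution of the count SERGM given B factorizes coordinatewise: for every s ∈ B, P_β(s)/P_β(B) = ∏_{ℓ=1}^k [ binom(S̄_ℓ, s_ℓ)·exp(β_ℓ s_ℓ) / Σ_{s'_ℓ ∈ B_ℓ} binom(S̄_ℓ, s'_ℓ)·exp(β_ℓ s'_ℓ) ]; in particular it equals the product over ℓ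 of the distribution of an independent Binomial(S̄_ℓ, e^{β_ℓ}/(1+e^{β_ℓ})) random variable conditioned on lying in B_ℓ. -/
open scoped Classical

/-- The unnormalized count weight is a product of one-dimensional weights. -/
theorem prod_choose_mul_exp_sum {ι : Type*} [Fintype ι] (n : ι → ℕ) (β : ι → ℝ) (s : ι → ℕ) :
    (∏ i, ((n i).choose (s i) : ℝ)) * Real.exp (∑ i, β i * (s i : ℝ)) =
      ∏ i, ((n i).choose (s i) : ℝ) * Real.exp (β i * (s i : ℝ)) := by
  rw [Real.exp_sum, Finset.prod_mul_distrib]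

/-- The binomial mass with success probability `e ^ b / (1 + e ^ b)` is the exponentially tilted
binomial coefficient, up to the factor `(1 + e ^ b) ^ n`. -/
theorem choose_mul_logistic_pow (n x : ℕ) (hx : x ≤ n) (b : ℝ) :
    (n.choose x : ℝ) * (Real.exp b / (1 + Real.exp b)) ^ x *
        (1 - Real.exp b / (1 + Real.exp b)) ^ (n - x) =
      (n.choose x : ℝ) * Real.exp (b * (x : ℝ)) / (1 + Real.exp b) ^ n := by
  have h : 1 + Real.exp b ≠ 0 := by positivity
  have hq : 1 - Real.exp b / (1 + Real.exp b) = 1 / (1 + Real.exp b) := by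
    field_simp
    ring
  rw [hq, mul_comm b, Real.exp_nat_mul, div_pow, div_pow, one_pow, ← Nat.add_sub_cancel' hx,
    pow_add, Nat.add_sub_cancel' hx]
  field_simp

/-- The conditional distribution of a count SERGM (weights
`K(s) = ∏_ℓ binom(S̄_ℓ, s_ℓ)`) given a product set `B = ∏_ℓ B_ℓ ⊆ A` factorizes
coordinatewise, each factor being the distribution of an independent
`Binomial(S̄_ℓ, e^{β_ℓ}/(1+e^{β_ℓ}))` random variable conditioned to lie in `B_ℓ`. -/
theorem stmt_3 (k : ℕ) (Sbar : Fin k → ℕ) (hSbar : ∀ ℓ, 1 ≤ Sbar ℓ)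
    (A : Finset (Fin k → ℕ)) (hAne : A.Nonempty)
    (hA : ∀ s ∈ A, ∀ ℓ, s ℓ ≤ Sbar ℓ)
    (β : Fin k → ℝ)
    (P : (Fin k → ℕ) → ℝ)
    (hP : ∀ s, P s =
      ((∏ ℓ, ((Sbar ℓ).choose (s ℓ) : ℝ)) * Real.exp (∑ ℓ, β ℓ * (s ℓ : ℝ))) /
        ∑ s' ∈ A, (∏ ℓ, ((Sbar ℓ).choose (s' ℓ) : ℝ)) * Real.exp (∑ ℓ, β ℓ * (s' ℓ : ℝ)))
    (Bl : Fin k → Finset ℕ) (hBlne : ∀ ℓ, (Bl ℓ).Nonempty)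
    (hBl : ∀ ℓ, ∀ x ∈ Bl ℓ, x ≤ Sbar ℓ)
    (hBA : Fintype.piFinset Bl ⊆ A)
    (p : Fin k → ℝ) (hp : ∀ ℓ, p ℓ = Real.exp (β ℓ) / (1 + Real.exp (β ℓ))) :
    ∀ s ∈ Fintype.piFinset Bl,
      (P s / ∑ s' ∈ Fintype.piFinset Bl, P s' =
        ∏ ℓ, (((Sbar ℓ).choose (s ℓ) : ℝ) * Real.exp (β ℓ * (s ℓ : ℝ))) /
          ∑ x ∈ Bl ℓ, ((Sbar ℓ).choose x : ℝ) * Real.exp (β ℓ * (x : ℝ))) ∧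
      (P s / ∑ s' ∈ Fintype.piFinset Bl, P s' =
        ∏ ℓ, (((Sbar ℓ).choose (s ℓ) : ℝ) * p ℓ ^ (s ℓ) * (1 - p ℓ) ^ (Sbar ℓ - s ℓ)) /
          ∑ x ∈ Bl ℓ, ((Sbar ℓ).choose x : ℝ) * p ℓ ^ x * (1 - p ℓ) ^ (Sbar ℓ - x)) := by
  intro s hs
  have hcond : P s / ∑ s' ∈ Fintype.piFinset Bl, P s' =
      ∏ ℓ, (((Sbar ℓ).choose (s ℓ) : ℝ) * Real.exp (β ℓ * (s ℓ : ℝ))) /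
        ∑ x ∈ Bl ℓ, ((Sbar ℓ).choose x : ℝ) * Real.exp (β ℓ * (x : ℝ)) := by
    have hZ : ∑ s' ∈ A,
        ∏ ℓ, ((Sbar ℓ).choose (s' ℓ) : ℝ) * Real.exp (β ℓ * (s' ℓ : ℝ)) ≠ 0 := by
      refine (Finset.sum_pos (fun s' hs' => Finset.prod_pos fun ℓ _ => ?_) hAne).ne'
      exact mul_pos (Nat.cast_pos.2 (Nat.choose_pos (hA s' hs' ℓ))) (Real.exp_pos _)
    simp_rw [hP, prod_choose_mul_exp_sum]
    rw [← Finset.sum_div, div_div_div_cancel_right₀ hZ, Finset.prod_div_distrib,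
      Finset.prod_univ_sum]
  refine ⟨hcond, hcond.trans (Finset.prod_congr rfl fun ℓ _ => ?_)⟩
  have hs' : s ℓ ≤ Sbar ℓ := hBl ℓ _ (Fintype.mem_piFinset.1 hs ℓ)
  have hne : (1 + Real.exp (β ℓ)) ^ Sbar ℓ ≠ 0 := by positivity
  rw [hp, choose_mul_logistic_pow _ _ hs',
    Finset.sum_congr rfl fun x hx => choose_mul_logistic_pow _ _ (hBl ℓ x hx) (β ℓ),
    ← Finset.sum_div, div_div_div_cancel_right₀ hne]
end

section
/- Consider a count SERGM with caps S̄ ∈ ℕ^k (each S̄_ℓ ≥ 1), nonempty domain A ⊆ ∏_{ℓ=1}^k {0,…,S̄_ℓ}, and parameter β ∈ ℝ^k. Let ν be the law on ∏_{ℓ=1}^k {0,…,S̄_ℓ} of a vector of k independent Binomial(S̄_ℓ, p_ℓ) random variables with p_ℓ = e^{β_ℓ}/(1+e^{β_ℓ}). Then for every s ∈ A, P_β(s) = ν({s})/ν(A); consequently P_β(s) ≥ ν({s}) for all s ∈ A, and if ν(A) ≥ 1 − ε for some ε ∈ (0,1) then ν({s}) ≤ P_β(s) ≤ ν({s})/(1−ε)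 for all s ∈ A. -/
/-- With logit `b`, an unnormalised binomial weight is the exponentially tilted one, up to a factor
that does not depend on the number of successes. -/
theorem logistic_pow_mul_one_sub_pow {b q : ℝ} (hq : q = Real.exp b / (1 + Real.exp b))
    {m n : ℕ} (h : m ≤ n) :
    q ^ m * (1 - q) ^ (n - m) = Real.exp (b * m) * (1 - q) ^ n := by
  have hodds : q = Real.exp b * (1 - q) := by
    have : 1 + Real.exp b ≠ 0 := by positivity
    rw [hq]
    field_simp
    ring
  calc q ^ m * (1 - q) ^ (n - m) = (Real.exp b * (1 - q)) ^ m * (1 - q) ^ (n - m) := by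
        rw [← hodds]
    _ = Real.exp (b * m) * (1 - q) ^ n := by
        rw [mul_pow, mul_assoc, ← pow_add, Nat.add_sub_cancel' h, ← Real.exp_nat_mul,
          mul_comm (m : ℝ)]

/-- The product binomial weights of any set of count vectors sum to at most one. -/
theorem sum_prod_binomial_le_one {ι : Type*} [Fintype ι] (N : ι → ℕ) {p : ι → ℝ}
    (hp0 : ∀ i, 0 ≤ p i) (hp1 : ∀ i, p i ≤ 1) {A : Finset (ι → ℕ)}
    (hA : ∀ s ∈ A, ∀ i, s i ≤ N i) :
    ∑ s ∈ A, ∏ i, ((N i).choose (s i) : ℝ) * p i ^ s i * (1 - p i) ^ (N i - s i) ≤ 1 := by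
  classical
  have hq (i : ι) : 0 ≤ 1 - p i := sub_nonneg.2 (hp1 i)
  have htotal (i : ι) : ∑ m ∈ Finset.range (N i + 1),
      ((N i).choose m : ℝ) * p i ^ m * (1 - p i) ^ (N i - m) = 1 := by
    have h := add_pow (p i) (1 - p i) (N i)
    rw [add_sub_cancel, one_pow] at h
    exact (Finset.sum_congr rfl fun m _ => by ring).trans h.symm
  have hprod := Finset.prod_univ_sum (fun i => Finset.range (N i + 1))
    fun i m => ((N i).choose m : ℝ) * p i ^ m * (1 - p i) ^ (N i - m)
  rw [Finset.prod_eq_one fun i _ => htotal i] at hprod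
  refine (Finset.sum_le_sum_of_subset_of_nonneg (fun s hs => ?_) fun s _ _ =>
    Finset.prod_nonneg fun i _ => mul_nonneg
      (mul_nonneg (Nat.cast_nonneg _) (pow_nonneg (hp0 i) _))
      (pow_nonneg (hq i) _)).trans hprod.ge
  exact Fintype.mem_piFinset.2 fun i => Finset.mem_range_succ_iff.2 (hA s hs i)

/-- A count SERGM with caps `S̄`, domain `A`, and parameter `β` is the
law `ν` of a vector of `k` independent `Binomial(S̄_ℓ, p_ℓ)` variables
(`p_ℓ = e^{β_ℓ}/(1+e^{β_ℓ})`) conditioned on `A`: `P_β(s) = ν({s})/ν(A)` for `s ∈ A`;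
hence `P_β(s) ≥ ν({s})`, and if `ν(A) ≥ 1 − ε` then
`ν({s}) ≤ P_β(s) ≤ ν({s})/(1−ε)` for all `s ∈ A`. -/
theorem stmt_4 (k : ℕ) (Sbar : Fin k → ℕ) (hSbar : ∀ ℓ, 1 ≤ Sbar ℓ)
    (A : Finset (Fin k → ℕ)) (hAne : A.Nonempty)
    (hA : ∀ s ∈ A, ∀ ℓ, s ℓ ≤ Sbar ℓ)
    (β : Fin k → ℝ)
    (p : Fin k → ℝ) (hp : ∀ ℓ, p ℓ = Real.exp (β ℓ) / (1 + Real.exp (β ℓ)))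
    (P ν : (Fin k → ℕ) → ℝ)
    (hP : ∀ s, P s =
      ((∏ ℓ, ((Sbar ℓ).choose (s ℓ) : ℝ)) * Real.exp (∑ ℓ, β ℓ * (s ℓ : ℝ))) /
        ∑ s' ∈ A, (∏ ℓ, ((Sbar ℓ).choose (s' ℓ) : ℝ)) * Real.exp (∑ ℓ, β ℓ * (s' ℓ : ℝ)))
    (hν : ∀ s, ν s =
      ∏ ℓ, ((Sbar ℓ).choose (s ℓ) : ℝ) * p ℓ ^ (s ℓ) * (1 - p ℓ) ^ (Sbar ℓ - s ℓ)) :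
    (∀ s ∈ A, P s = ν s / ∑ s' ∈ A, ν s') ∧
    (∀ s ∈ A, ν s ≤ P s) ∧
    (∀ ε : ℝ, 0 < ε → ε < 1 → 1 - ε ≤ ∑ s' ∈ A, ν s' →
      ∀ s ∈ A, ν s ≤ P s ∧ P s ≤ ν s / (1 - ε)) := by
  have hp0 (ℓ) : 0 < p ℓ := by rw [hp]; positivity
  have hp1 (ℓ) : p ℓ < 1 := by
    rw [hp, div_lt_one (by positivity)]
    linarith
  have hfactor : ∀ s ∈ A, ν s = ((∏ ℓ, ((Sbar ℓ).choose (s ℓ) : ℝ)) *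
      Real.exp (∑ ℓ, β ℓ * (s ℓ : ℝ))) * ∏ ℓ, (1 - p ℓ) ^ Sbar ℓ := by
    intro s hs
    rw [hν, Real.exp_sum, ← Finset.prod_mul_distrib, ← Finset.prod_mul_distrib]
    refine Finset.prod_congr rfl fun ℓ _ => ?_
    rw [mul_assoc, logistic_pow_mul_one_sub_pow (hp ℓ) (hA s hs ℓ), mul_assoc]
  have hCpos : 0 < ∏ ℓ, (1 - p ℓ) ^ Sbar ℓ :=
    Finset.prod_pos fun ℓ _ => pow_pos (sub_pos.2 (hp1 ℓ)) _
  have hνpos : ∀ s ∈ A, 0 < ν s := by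
    intro s hs
    rw [hν]
    exact Finset.prod_pos fun ℓ _ => mul_pos
      (mul_pos (Nat.cast_pos.2 (Nat.choose_pos (hA s hs ℓ))) (pow_pos (hp0 ℓ) _))
      (pow_pos (sub_pos.2 (hp1 ℓ)) _)
  have hsum_pos : 0 < ∑ s ∈ A, ν s := Finset.sum_pos hνpos hAne
  have hsum_le : ∑ s ∈ A, ν s ≤ 1 := by
    simp only [hν]
    exact sum_prod_binomial_le_one Sbar (fun ℓ => (hp0 ℓ).le) (fun ℓ => (hp1 ℓ).le) hA
  have hcond : ∀ s ∈ A, P s = ν s / ∑ s' ∈ A, ν s' := by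
    intro s hs
    rw [hP, hfactor s hs, Finset.sum_congr rfl hfactor, ← Finset.sum_mul,
      mul_div_mul_right _ _ hCpos.ne']
  have hlower : ∀ s ∈ A, ν s ≤ P s := by
    intro s hs
    rw [hcond s hs]
    exact le_div_self (hνpos s hs).le hsum_pos hsum_le
  refine ⟨hcond, hlower, fun ε _ hε1 hε s hs => ⟨hlower s hs, ?_⟩⟩
  rw [hcond s hs]
  exact div_le_div_of_nonneg_left (hνpos s hs).le (sub_pos.2 hε1) hε
end

section
/- For each n ∈ ℕ let S̄^n ∈ ℕ^k with S̄^n_ℓ → ∞ for every ℓ, let A^n ⊆ ∏_ℓ {0,…,S̄^n_ℓ} be nonempty domains, let β^n ∈ ℝ^k, and set p^n_ℓ = e^{β^n_ℓ}/(1+e^{β^n_ℓ}). Assume: (i) the sequence is non-conflicted, i.e., there exist ε ∈ (0,1) and N such that for all n ≥ N the product set ∏_ℓ { ⌊p^n_ℓ S̄^n_ℓ (1−ε)⌋, ⌊p^n_ℓ S̄^n_ℓ (1−ε)⌋+1, …, ⌈p^n_ℓ S̄^n_ℓ (1+ε)⌉ } is contained in A^n; (ii) p^n_ℓ · S̄^n_ℓ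 → ∞ for every ℓ; and (iii) limsup_n p^n_ℓ < 1 for every ℓ. Let S^n be distributed according to the count SERGM with caps S̄^n, domain A^n, and parameter β^n, and define the estimator β̂^n_ℓ = log( S^n_ℓ / (S̄^n_ℓ − S^n_ℓ) ) when 0 < S^n_ℓ < S̄^n_ℓ (and β̂^n_ℓ = 0 otherwise). Then: (a) max_ℓ |β̂^n_ℓ − β^n_ℓ| → 0 in probability; and (b) for each ℓ, the law of √(S̄^n_ℓ · p^n_ℓ · (1−p^n_ℓ)) · (β̂^n_ℓ − β^n_ℓ) converges weakly to the standard Gaussian measure on ℝ. -/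
open Filter MeasureTheory

/-- The probability that a binomial variable with parameters `m` and `p` equals `j`. -/
noncomputable def binomialWeight (m : ℕ) (p : ℝ) (j : ℕ) : ℝ :=
  m.choose j * p ^ j * (1 - p) ^ (m - j)

lemma binomialWeight_nonneg {p : ℝ} (h0 : 0 ≤ p) (h1 : p ≤ 1) (m j : ℕ) :
    0 ≤ binomialWeight m p j := by
  have : 0 ≤ 1 - p := by linarith
  unfold binomialWeight
  positivity

lemma sum_binomialWeight (m : ℕ) (p : ℝ) :
    ∑ j ∈ Finset.range (m + 1), binomialWeight m p j = 1 := by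
  have h := (add_pow p (1 - p) m).symm
  rw [add_sub_cancel, one_pow] at h
  rw [← h]
  exact Finset.sum_congr rfl fun j _ ↦ by unfold binomialWeight; ring

lemma sum_binomialWeight_mul_sq (m : ℕ) (p : ℝ) :
    ∑ j ∈ Finset.range (m + 1), binomialWeight m p j * ((j : ℝ) - m * p) ^ 2 =
      m * p * (1 - p) := by
  have h := congrArg (Polynomial.eval p) (bernsteinPolynomial.variance ℝ m)
  simp only [bernsteinPolynomial, nsmul_eq_mul, Polynomial.eval_finsetSum, Polynomial.eval_mul,
    Polynomial.eval_pow, Polynomial.eval_sub, Polynomial.eval_natCast, Polynomial.eval_X,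
    Polynomial.eval_one] at h
  rw [← h]
  exact Finset.sum_congr rfl fun j _ ↦ by unfold binomialWeight; ring

lemma sum_binomialWeight_mul_sq_div {m : ℕ} {p : ℝ} (hm : 0 < p * m) :
    ∑ j ∈ Finset.range (m + 1), binomialWeight m p j * (((j : ℝ) - m * p) / (m * p)) ^ 2 =
      (1 - p) / (p * m) := by
  simp_rw [div_pow, ← mul_div_assoc]
  rw [← Finset.sum_div, sum_binomialWeight_mul_sq]
  have hp : p ≠ 0 := left_ne_zero_of_mul hm.ne'
  have hm' : (m : ℝ) ≠ 0 := right_ne_zero_of_mul hm.ne'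
  field_simp

lemma sum_binomialWeight_mul_cexp (m : ℕ) (p a : ℝ) :
    ∑ j ∈ Finset.range (m + 1), (binomialWeight m p j : ℂ) *
        Complex.exp ((a * ((j : ℝ) - m * p) : ℝ) * Complex.I) =
      ((1 - p) * Complex.exp ((-(a * p) : ℝ) * Complex.I) +
        p * Complex.exp ((a * (1 - p) : ℝ) * Complex.I)) ^ m := by
  conv_rhs => rw [add_comm, add_pow]
  refine Finset.sum_congr rfl fun j hj ↦ ?_
  have hj : j ≤ m := by simpa [Nat.lt_succ_iff] using hj
  obtain ⟨l, rfl⟩ := Nat.exists_eq_add_of_le hj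
  rw [mul_pow, mul_pow, ← Complex.exp_nat_mul, ← Complex.exp_nat_mul, Nat.add_sub_cancel_left]
  have : Complex.exp ((a * ((j : ℝ) - (j + l : ℕ) * p) : ℝ) * Complex.I) =
      Complex.exp (j * ((a * (1 - p) : ℝ) * Complex.I)) *
        Complex.exp (l * ((-(a * p) : ℝ) * Complex.I)) := by
    rw [← Complex.exp_add]
    congr 1
    push_cast
    ring
  rw [this]
  simp only [binomialWeight, Nat.add_sub_cancel_left]
  push_cast
  ring

lemma norm_pow_sub_pow_le_mul {z w : ℂ} (hz : ‖z‖ ≤ 1) (hw : ‖w‖ ≤ 1) (m : ℕ) :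
    ‖z ^ m - w ^ m‖ ≤ m * ‖z - w‖ := by
  induction m with
  | zero => simp
  | succ m ih =>
    have h : z ^ (m + 1) - w ^ (m + 1) = z * (z ^ m - w ^ m) + (z - w) * w ^ m := by ring
    rw [h]
    refine (norm_add_le _ _).trans ?_
    rw [norm_mul, norm_mul, norm_pow]
    have h1 : ‖z‖ * ‖z ^ m - w ^ m‖ ≤ 1 * (m * ‖z - w‖) := by gcongr
    have h2 : ‖z - w‖ * ‖w‖ ^ m ≤ ‖z - w‖ * 1 := by
      gcongr
      exact pow_le_one₀ (norm_nonneg _) hw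
    push_cast
    linarith

lemma norm_cexp_mul_I_sub_le {x : ℝ} (hx : |x| ≤ 1) :
    ‖Complex.exp (x * Complex.I) - (1 + x * Complex.I - x ^ 2 / 2)‖ ≤ |x| ^ 3 := by
  have hn : ‖(x * Complex.I : ℂ)‖ = |x| := by simp
  have h := Complex.exp_bound (x := x * Complex.I) (by rw [hn]; exact hx) (n := 3) (by norm_num)
  rw [hn] at h
  have hs : ∑ i ∈ Finset.range 3, (x * Complex.I : ℂ) ^ i / (i.factorial : ℂ) =
      1 + x * Complex.I - x ^ 2 / 2 := by
    simp [Finset.sum_range_succ, mul_pow]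
    ring
  rw [hs] at h
  refine h.trans (mul_le_of_le_one_right (by positivity) ?_)
  norm_num [Nat.factorial]

/-- A quantitative central limit theorem for characteristic functions of binomial laws. -/
lemma norm_sum_binomialWeight_mul_cexp_sub_le {m : ℕ} {p σ t : ℝ} (h0 : 0 < p) (h1 : p < 1)
    (hσ : 0 < σ) (hσm : σ ^ 2 = m * p * (1 - p)) (ht : |t| ≤ σ) :
    ‖∑ j ∈ Finset.range (m + 1), (binomialWeight m p j : ℂ) *
        Complex.exp ((t * (((j : ℝ) - m * p) / σ) : ℝ) * Complex.I) -
      Complex.exp (-(t ^ 2 / 2 : ℝ))‖ ≤ |t| ^ 3 / σ + t ^ 4 / σ ^ 2 := by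
  set a := t / σ with ha
  have hq : 0 < 1 - p := by linarith
  have hsum := sum_binomialWeight_mul_cexp m p a
  have hm : (0 : ℝ) < m := by
    rcases Nat.eq_zero_or_pos m with rfl | h
    · simp at hσm; exact absurd hσm hσ.ne'
    · exact_mod_cast h
  have hσm' : σ ^ 2 ≤ m := by
    rw [hσm, mul_assoc]
    exact mul_le_of_le_one_right hm.le (by nlinarith)
  have ha1 : |a| ≤ 1 := by
    rw [ha, abs_div, abs_of_pos hσ]
    exact div_le_one_of_le₀ ht hσ.le
  have hrw : ∀ j : ℕ, t * (((j : ℝ) - m * p) / σ) = a * ((j : ℝ) - m * p) := by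
    intro j; rw [ha]; ring
  simp_rw [hrw]
  rw [hsum]
  set F : ℂ := (1 - p) * Complex.exp ((-(a * p) : ℝ) * Complex.I) +
        p * Complex.exp ((a * (1 - p) : ℝ) * Complex.I) with hF
  have hFn : ‖F‖ ≤ 1 := by
    refine (norm_add_le _ _).trans ?_
    rw [norm_mul, norm_mul, Complex.norm_exp_ofReal_mul_I, Complex.norm_exp_ofReal_mul_I,
      ← Complex.ofReal_one, ← Complex.ofReal_sub, Complex.norm_real, Complex.norm_real,
      Real.norm_of_nonneg hq.le, Real.norm_of_nonneg h0.le]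
    linarith
  set x : ℝ := t ^ 2 / (2 * m) with hx
  have hx0 : 0 ≤ x := by positivity
  have ht2 : t ^ 2 ≤ σ ^ 2 := sq_le_sq' (by linarith [neg_abs_le t]) ((le_abs_self t).trans ht)
  have hx1 : x ≤ 1 := by
    rw [hx, div_le_one (by positivity)]
    linarith
  set w : ℂ := Complex.exp ((-x : ℝ)) with hw
  have hwn : ‖w‖ ≤ 1 := by
    rw [hw, Complex.norm_exp, Complex.ofReal_re]
    exact Real.exp_le_one_iff.2 (by linarith)
  have hwm : Complex.exp (-(t ^ 2 / 2 : ℝ)) = w ^ m := by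
    rw [hw, ← Complex.exp_nat_mul, ← Complex.ofReal_neg, ← Complex.ofReal_natCast,
      ← Complex.ofReal_mul]
    congr 2
    rw [hx]; field_simp
  have hax : a ^ 2 * (p * (1 - p)) / 2 = x := by
    rw [ha, hx, div_pow, hσm]; field_simp
  have hFx : ‖F - (1 - x)‖ ≤ p * (1 - p) * |a| ^ 3 := by
    have e1 := norm_cexp_mul_I_sub_le (x := -(a * p)) (by
      rw [abs_neg, abs_mul, abs_of_pos h0]; nlinarith [abs_nonneg a])
    have e2 := norm_cexp_mul_I_sub_le (x := a * (1 - p)) (by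
      rw [abs_mul, abs_of_pos hq]; nlinarith [abs_nonneg a])
    have key : F - (1 - x) = ((1 - p : ℝ) : ℂ) * (Complex.exp ((-(a * p) : ℝ) * Complex.I) -
          (1 + (-(a * p) : ℝ) * Complex.I - (-(a * p) : ℝ) ^ 2 / 2)) +
        (p : ℂ) * (Complex.exp ((a * (1 - p) : ℝ) * Complex.I) -
          (1 + (a * (1 - p) : ℝ) * Complex.I - (a * (1 - p) : ℝ) ^ 2 / 2)) := by
      rw [hF, ← hax]
      push_cast
      ring
    rw [key]
    refine (norm_add_le _ _).trans ?_
    rw [norm_mul, norm_mul, Complex.norm_real, Complex.norm_real,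
      Real.norm_of_nonneg hq.le, Real.norm_of_nonneg h0.le]
    rw [abs_neg, abs_mul, abs_of_pos h0, mul_pow] at e1
    rw [abs_mul, abs_of_pos hq, mul_pow] at e2
    have h3 : 0 ≤ |a| ^ 3 := by positivity
    calc _ ≤ (1 - p) * (|a| ^ 3 * p ^ 3) + p * (|a| ^ 3 * (1 - p) ^ 3) := by gcongr
      _ = p * (1 - p) * |a| ^ 3 * (p ^ 2 + (1 - p) ^ 2) := by ring
      _ ≤ p * (1 - p) * |a| ^ 3 * 1 := by
        refine mul_le_mul_of_nonneg_left ?_ (by positivity)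
        nlinarith
      _ = _ := by ring
  have hwx : ‖(1 - x) - w‖ ≤ x ^ 2 := by
    have e := Real.abs_exp_sub_one_sub_id_le (x := -x) (by rw [abs_neg, abs_of_nonneg hx0]; exact hx1)
    rw [hw, ← Complex.ofReal_exp, ← Complex.ofReal_one, ← Complex.ofReal_sub, ← Complex.ofReal_sub,
      Complex.norm_real, Real.norm_eq_abs, abs_sub_comm]
    convert e using 1
    · congr 1; ring
    · ring
  rw [hwm]
  refine (norm_pow_sub_pow_le_mul hFn hwn m).trans ?_
  have htri : ‖F - w‖ ≤ p * (1 - p) * |a| ^ 3 + x ^ 2 := by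
    calc ‖F - w‖ = ‖(F - (1 - x)) + ((1 - x) - w)‖ := by congr 1; ring
      _ ≤ _ := (norm_add_le _ _).trans (add_le_add hFx hwx)
  calc (m : ℝ) * ‖F - w‖ ≤ m * (p * (1 - p) * |a| ^ 3 + x ^ 2) := by gcongr
    _ = σ ^ 2 * |a| ^ 3 + t ^ 4 / (4 * m) := by
      rw [hσm, hx]; field_simp; ring
    _ ≤ _ := by
      have : σ ^ 2 * |a| ^ 3 = |t| ^ 3 / σ := by
        rw [ha, abs_div, abs_of_pos hσ]; field_simp
      rw [this]
      gcongr
      linarith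

/-- The log-odds estimator based on `j` successes out of `m`, and `0` if it is undefined. -/
noncomputable def logOdds (m j : ℕ) : ℝ :=
  if 0 < j ∧ j < m then Real.log ((j : ℝ) / ((m : ℝ) - j)) else 0

lemma abs_log_one_add_sub_le {u : ℝ} (hu : |u| ≤ 1 / 2) : |Real.log (1 + u) - u| ≤ 2 * u ^ 2 := by
  have h := Real.abs_log_sub_add_sum_range_le (x := -u) (by rw [abs_neg]; linarith) 1
  simp only [Finset.sum_range_one, abs_neg, sub_neg_eq_add] at h
  norm_num at h
  rw [sub_eq_neg_add]
  refine h.trans ?_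
  rw [div_le_iff₀ (by linarith)]
  nlinarith [sq_nonneg u, sq_abs u]

lemma abs_logOdds_sub_le {m j : ℕ} {p δ u : ℝ} (h0 : 0 < p) (hδ : 0 < δ) (hp : p ≤ 1 - δ)
    (hm : 0 < m) (hu : u = ((j : ℝ) - m * p) / (m * p)) (hb : |u| ≤ δ / 2) :
    |logOdds m j - Real.log (p / (1 - p)) - u / (1 - p)| ≤ 4 * u ^ 2 / δ ^ 2 := by
  have hm' : (0 : ℝ) < m := by exact_mod_cast hm
  have hq : 0 < 1 - p := by linarith
  set v : ℝ := -(u * p / (1 - p)) with hv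
  have hδ1 : δ < 1 := by linarith
  have hvu : |v| ≤ |u| / δ := by
    rw [hv, abs_neg, abs_div, abs_mul, abs_of_pos h0, abs_of_pos hq]
    have : |u| * p ≤ |u| := mul_le_of_le_one_right (abs_nonneg _) (by linarith)
    gcongr
    linarith
  have hv2 : |v| ≤ 1 / 2 := by
    refine hvu.trans ?_
    rw [div_le_iff₀ hδ]; linarith
  have hu2 : |u| ≤ 1 / 2 := by linarith
  have hj : (j : ℝ) = m * p * (1 + u) := by rw [hu]; field_simp; ring
  have hmj : (m : ℝ) - j = m * (1 - p) * (1 + v) := by rw [hj, hv]; field_simp; ring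
  have hu1 : 0 < 1 + u := by linarith [neg_abs_le u]
  have hv1 : 0 < 1 + v := by linarith [neg_abs_le v]
  have hjpos : (0 : ℝ) < j := by rw [hj]; positivity
  have hmjpos : (0 : ℝ) < m - j := by rw [hmj]; positivity
  have hcond : 0 < j ∧ j < m := ⟨by exact_mod_cast hjpos, by exact_mod_cast sub_pos.1 hmjpos⟩
  have hlog : logOdds m j = Real.log (p / (1 - p)) + (Real.log (1 + u) - Real.log (1 + v)) := by
    rw [logOdds, if_pos hcond, hmj, hj, ← Real.log_div hu1.ne' hv1.ne',
      ← Real.log_mul (by positivity) (by positivity)]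
    congr 1
    field_simp
  have hdiff : u / (1 - p) = u - v := by rw [hv]; field_simp; ring
  rw [hlog, hdiff]
  have hle : v ^ 2 ≤ u ^ 2 / δ ^ 2 := by
    rw [← sq_abs v, ← sq_abs u, ← div_pow]
    gcongr
  have hle' : u ^ 2 ≤ u ^ 2 / δ ^ 2 := by
    rw [le_div_iff₀ (by positivity)]
    exact mul_le_of_le_one_right (sq_nonneg _) (pow_le_one₀ hδ.le hδ1.le)
  calc _ = |(Real.log (1 + u) - u) - (Real.log (1 + v) - v)| := by congr 1; ring
    _ ≤ 2 * u ^ 2 + 2 * v ^ 2 := (abs_sub _ _).trans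
        (add_le_add (abs_log_one_add_sub_le hu2) (abs_log_one_add_sub_le hv2))
    _ ≤ 4 * (u ^ 2 / δ ^ 2) := by linarith
    _ = _ := by ring

/-- Weak convergence of functionals of binomial variables to the standard Gaussian, from pointwise
convergence of characteristic functions. -/
lemma tendsto_sum_binomialWeight_of_charFun {m : ℕ → ℕ} {p : ℕ → ℝ} (h0 : ∀ n, 0 ≤ p n)
    (h1 : ∀ n, p n ≤ 1) (Y : ℕ → ℕ → ℝ)
    (h : ∀ t : ℝ, Tendsto (fun n ↦ ∑ j ∈ Finset.range (m n + 1),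
      (binomialWeight (m n) (p n) j : ℂ) * Complex.exp ((t * Y n j : ℝ) * Complex.I)) atTop
      (nhds (Complex.exp (-(t ^ 2 / 2 : ℝ)))))
    {f : ℝ → ℝ} (hf : Continuous f) {C : ℝ} (hC : ∀ x, |f x| ≤ C) :
    Tendsto (fun n ↦ ∑ j ∈ Finset.range (m n + 1), binomialWeight (m n) (p n) j * f (Y n j)) atTop
      (nhds (∫ x, f x ∂(ProbabilityTheory.gaussianReal 0 1))) := by
  let ν : ℕ → Measure ℕ := fun n ↦ ProbabilityTheory.binomial (m n) ⟨p n, h0 n, h1 n⟩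
  have hν : ∀ n, IsProbabilityMeasure (ν n) := fun n ↦ inferInstanceAs
    (IsProbabilityMeasure (ProbabilityTheory.binomial _ _))
  have hmap : ∀ n, IsProbabilityMeasure ((ν n).map (Y n)) := fun n ↦
    Measure.isProbabilityMeasure_map .of_discrete
  let μ : ℕ → ProbabilityMeasure ℝ := fun n ↦ ⟨(ν n).map (Y n), hmap n⟩
  let μ₀ : ProbabilityMeasure ℝ := ⟨ProbabilityTheory.gaussianReal 0 1, inferInstance⟩
  have hrange : ∀ n, Finset.Iic (m n) = Finset.range (m n + 1) := fun n ↦ by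
    ext; simp
  have hlim : Tendsto μ atTop (nhds μ₀) := by
    rw [ProbabilityMeasure.tendsto_iff_tendsto_charFun]
    intro t
    have e0 : charFun (μ₀ : Measure ℝ) t = Complex.exp (-(t ^ 2 / 2 : ℝ)) := by
      simp only [μ₀, ProbabilityMeasure.coe_mk, ProbabilityTheory.charFun_gaussianReal]
      congr 1
      push_cast
      ring_nf
    rw [e0]
    refine (h t).congr fun n ↦ ?_
    simp only [μ, ProbabilityMeasure.coe_mk]
    rw [charFun_apply_real, integral_map .of_discrete (by fun_prop)]
    simp only [ν]
    rw [ProbabilityTheory.integral_binomial, hrange]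
    refine Finset.sum_congr rfl fun j _ ↦ ?_
    simp only [binomialWeight, Complex.real_smul, Complex.ofReal_mul]
  have hint := ProbabilityMeasure.tendsto_iff_forall_integral_tendsto.1 hlim
    (BoundedContinuousFunction.ofNormedAddCommGroup f hf C fun x ↦ by simpa using hC x)
  simp only [BoundedContinuousFunction.coe_ofNormedAddCommGroup] at hint
  refine hint.congr fun n ↦ ?_
  simp only [μ, ProbabilityMeasure.coe_mk]
  rw [integral_map .of_discrete hf.aestronglyMeasurable]
  simp only [ν]
  rw [ProbabilityTheory.integral_binomial, hrange]
  simp only [binomialWeight, smul_eq_mul]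

section Asymptotics

variable {m : ℕ → ℕ} {p : ℕ → ℝ} {δ : ℝ}

lemma sum_binomialWeight_mul_sq_div_le {m : ℕ} {p : ℝ} (h0 : 0 < p) (hm : 0 < p * m) :
    ∑ j ∈ Finset.range (m + 1), binomialWeight m p j * (((j : ℝ) - m * p) / (m * p)) ^ 2 ≤
      1 / (p * m) := by
  rw [sum_binomialWeight_mul_sq_div hm]
  gcongr
  linarith

/-- **Chebyshev's inequality** for the relative deviation of a binomial variable. -/
lemma sum_binomialWeight_indicator_le {m : ℕ} {p η : ℝ} (h0 : 0 < p) (h1 : p ≤ 1)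
    (hm : 0 < p * m) (hη : 0 < η) {B : ℕ → Prop} [DecidablePred B]
    (hB : ∀ j, B j → η ≤ |((j : ℝ) - m * p) / (m * p)|) :
    ∑ j ∈ Finset.range (m + 1), binomialWeight m p j * (if B j then 1 else 0) ≤
      1 / η ^ 2 * (1 / (p * m)) := by
  refine le_trans (b := ∑ j ∈ Finset.range (m + 1), 1 / η ^ 2 *
    (binomialWeight m p j * (((j : ℝ) - m * p) / (m * p)) ^ 2)) ?_ ?_
  · refine Finset.sum_le_sum fun j _ ↦ ?_
    rw [mul_left_comm]
    refine mul_le_mul_of_nonneg_left ?_ (binomialWeight_nonneg h0.le h1 m j)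
    split_ifs with h
    · rw [one_div_mul_eq_div, one_le_div (by positivity), ← sq_abs (_ / _)]
      gcongr
      exact hB j h
    · positivity
  · rw [← Finset.mul_sum]
    gcongr
    exact sum_binomialWeight_mul_sq_div_le h0 hm

/-- Consistency of the log-odds estimator. -/
lemma tendsto_sum_binomialWeight_logOdds_deviation (h0 : ∀ n, 0 < p n)
    (hδ : 0 < δ) (hp : ∀ᶠ n in atTop, p n ≤ 1 - δ)
    (hgrow : Tendsto (fun n ↦ p n * (m n : ℝ)) atTop atTop) {ε : ℝ} (hε : 0 < ε) :
    Tendsto (fun n ↦ ∑ j ∈ Finset.range (m n + 1), binomialWeight (m n) (p n) j *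
      (if ε < |logOdds (m n) j - Real.log (p n / (1 - p n))| then 1 else 0)) atTop (nhds 0) := by
  set η := min (δ / 2) (δ * ε / 4) with hη
  have hη0 : 0 < η := lt_min (by positivity) (by positivity)
  have hlim : Tendsto (fun n ↦ 1 / η ^ 2 * (1 / (p n * (m n : ℝ)))) atTop (nhds 0) := by
    have := (tendsto_inv_atTop_zero.comp hgrow).const_mul (1 / η ^ 2)
    rw [mul_zero] at this
    simpa only [one_div, Function.comp_def] using this
  refine squeeze_zero' ?_ ?_ hlim
  · filter_upwards [hp] with n hpn
    refine Finset.sum_nonneg fun j _ ↦ mul_nonneg (binomialWeight_nonneg (h0 n).le (by linarith) _ _) ?_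
    split_ifs <;> norm_num
  · filter_upwards [hp, hgrow.eventually_gt_atTop 0] with n hpn hgn
    refine sum_binomialWeight_indicator_le (h0 n) (by linarith) hgn hη0 fun j hj ↦ ?_
    by_contra! hlt
    set u := ((j : ℝ) - m n * p n) / (m n * p n) with hu
    have hm : 0 < m n := by
      have := (pos_iff_pos_of_mul_pos hgn).1 (h0 n)
      exact_mod_cast this
    have hq : δ ≤ 1 - p n := by linarith
    have hb := abs_logOdds_sub_le (h0 n) hδ hpn hm hu (hlt.le.trans (min_le_left _ _))
    have h1 : |u| < δ / 2 := hlt.trans_le (min_le_left _ _)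
    have h2 : |u| < δ * ε / 4 := hlt.trans_le (min_le_right _ _)
    have h3 : |u / (1 - p n)| ≤ |u| / δ := by
      rw [abs_div, abs_of_pos (hδ.trans_le hq)]
      gcongr
    have h4 : 4 * u ^ 2 / δ ^ 2 ≤ 2 * (|u| / δ) := by
      rw [← sq_abs u]
      have : 2 * (|u| / δ) - 4 * |u| ^ 2 / δ ^ 2 = 4 * |u| / δ ^ 2 * (δ / 2 - |u|) := by
        field_simp
        ring
      have h5 : 0 ≤ 4 * |u| / δ ^ 2 * (δ / 2 - |u|) :=
        mul_nonneg (by positivity) (by linarith)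
      linarith
    have h6 : |u| / δ < ε / 4 := by
      rw [div_lt_iff₀ hδ]; linarith
    have h7 := abs_sub_abs_le_abs_sub (logOdds (m n) j - Real.log (p n / (1 - p n))) (u / (1 - p n))
    linarith

/-- Asymptotic normality of the log-odds estimator. -/
lemma tendsto_sum_binomialWeight_logOdds (h0 : ∀ n, 0 < p n) (h1 : ∀ n, p n < 1)
    (hδ : 0 < δ) (hp : ∀ᶠ n in atTop, p n ≤ 1 - δ)
    (hgrow : Tendsto (fun n ↦ p n * (m n : ℝ)) atTop atTop)
    {f : ℝ → ℝ} (hf : Continuous f) {C : ℝ} (hC : ∀ x, |f x| ≤ C) :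
    Tendsto (fun n ↦ ∑ j ∈ Finset.range (m n + 1), binomialWeight (m n) (p n) j *
      f (√((m n : ℝ) * p n * (1 - p n)) * (logOdds (m n) j - Real.log (p n / (1 - p n))))) atTop
      (nhds (∫ x, f x ∂(ProbabilityTheory.gaussianReal 0 1))) := by
  refine tendsto_sum_binomialWeight_of_charFun (fun n ↦ (h0 n).le) (fun n ↦ (h1 n).le)
    (fun n j ↦ √((m n : ℝ) * p n * (1 - p n)) * (logOdds (m n) j - Real.log (p n / (1 - p n))))
    (fun t ↦ ?_) hf hC
  have hvar : Tendsto (fun n ↦ (m n : ℝ) * p n * (1 - p n)) atTop atTop := by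
    refine tendsto_atTop_mono' atTop ?_ (hgrow.atTop_mul_const hδ)
    filter_upwards [hp, hgrow.eventually_ge_atTop 0] with n hpn hgn
    rw [mul_comm (m n : ℝ)]
    gcongr
    linarith
  have hsd := Real.tendsto_sqrt_atTop.comp hvar
  simp only [Function.comp_def] at hsd
  have hmain : Tendsto (fun n ↦ |t| ^ 3 / √((m n : ℝ) * p n * (1 - p n)) +
      t ^ 4 / √((m n : ℝ) * p n * (1 - p n)) ^ 2) atTop (nhds 0) := by
    simpa using (tendsto_const_nhds.div_atTop hsd).add
      (tendsto_const_nhds.div_atTop ((tendsto_pow_atTop (two_ne_zero)).comp hsd))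
  have herr : Tendsto (fun n ↦ 4 / δ ^ 2 *
      (|t| * (√(p n * (m n : ℝ)))⁻¹ + 2 * (p n * (m n : ℝ))⁻¹)) atTop (nhds 0) := by
    have e1 := tendsto_inv_atTop_zero.comp (Real.tendsto_sqrt_atTop.comp hgrow)
    have e2 := tendsto_inv_atTop_zero.comp hgrow
    simpa [Function.comp_def] using ((e1.const_mul |t|).add (e2.const_mul 2)).const_mul (4 / δ ^ 2)
  rw [tendsto_iff_norm_sub_tendsto_zero]
  refine squeeze_zero' (.of_forall fun _ ↦ norm_nonneg _) ?_ (by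
    have := herr.add hmain
    rwa [add_zero] at this)
  filter_upwards [hp, hgrow.eventually_gt_atTop 0, hvar.eventually_gt_atTop 0,
    hsd.eventually_ge_atTop |t|] with n hpn hgn hvn htn
  set σ := √((m n : ℝ) * p n * (1 - p n)) with hσ
  have hσ0 : 0 < σ := Real.sqrt_pos.2 hvn
  have hσ2 : σ ^ 2 = (m n : ℝ) * p n * (1 - p n) := Real.sq_sqrt hvn.le
  have hm : 0 < m n := by
    have := (pos_iff_pos_of_mul_pos hgn).1 (h0 n)
    exact_mod_cast this
  have hclt := norm_sum_binomialWeight_mul_cexp_sub_le (h0 n) (h1 n) hσ0 hσ2 htn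
  refine (norm_sub_le_norm_sub_add_norm_sub _ _ _).trans (add_le_add ?_ hclt)
  rw [← Finset.sum_sub_distrib]
  set K := 4 / δ ^ 2 * (|t| * √(p n * (m n : ℝ)) + 2) with hK
  have hpt : ∀ j ∈ Finset.range (m n + 1), ‖(binomialWeight (m n) (p n) j : ℂ) *
      Complex.exp ((t * (σ * (logOdds (m n) j - Real.log (p n / (1 - p n)))) : ℝ) * Complex.I) -
      (binomialWeight (m n) (p n) j : ℂ) *
      Complex.exp ((t * (((j : ℝ) - m n * p n) / σ) : ℝ) * Complex.I)‖ ≤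
      K * (binomialWeight (m n) (p n) j * (((j : ℝ) - m n * p n) / (m n * p n)) ^ 2) := by
    intro j _
    set u := ((j : ℝ) - m n * p n) / (m n * p n) with hu
    rw [← mul_sub, norm_mul, Complex.norm_real,
      Real.norm_of_nonneg (binomialWeight_nonneg (h0 n).le (h1 n).le _ _), mul_left_comm K]
    refine mul_le_mul_of_nonneg_left ?_ (binomialWeight_nonneg (h0 n).le (h1 n).le _ _)
    have hz : ((j : ℝ) - m n * p n) / σ = σ * (u / (1 - p n)) := by
      have hm' : (m n : ℝ) ≠ 0 := by positivity
      have hp' := (h0 n).ne'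
      have hq' : 1 - p n ≠ 0 := by linarith [h1 n]
      rw [div_eq_iff hσ0.ne', mul_right_comm, ← sq, hσ2, hu]
      field_simp
    have hσle : σ ≤ √(p n * (m n : ℝ)) := by
      refine Real.sqrt_le_sqrt ?_
      rw [mul_comm (m n : ℝ)]
      exact mul_le_of_le_one_right hgn.le (by linarith [h0 n])
    by_cases hb : |u| ≤ δ / 2
    · have hl := abs_logOdds_sub_le (h0 n) hδ hpn hm hu hb
      have hexp : ∀ x y : ℝ, ‖Complex.exp (x * Complex.I) - Complex.exp (y * Complex.I)‖ ≤
          |x - y| := by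
        intro x y
        have e : Complex.exp (x * Complex.I) - Complex.exp (y * Complex.I) =
            Complex.exp (y * Complex.I) * (Complex.exp (Complex.I * (x - y : ℝ)) - 1) := by
          rw [mul_sub, ← Complex.exp_add]
          push_cast
          ring_nf
        rw [e, norm_mul, Complex.norm_exp_ofReal_mul_I, one_mul]
        exact Real.norm_exp_I_mul_ofReal_sub_one_le
      refine (hexp _ _).trans ?_
      rw [hz, ← mul_sub, ← mul_sub, abs_mul, abs_mul, abs_of_pos hσ0]
      calc _ ≤ |t| * (√(p n * (m n : ℝ)) * (4 * u ^ 2 / δ ^ 2)) := by gcongr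
        _ = 4 / δ ^ 2 * (|t| * √(p n * (m n : ℝ))) * u ^ 2 := by ring
        _ ≤ K * u ^ 2 := by
          rw [hK]
          gcongr
          linarith
    · push Not at hb
      refine (norm_sub_le _ _).trans ?_
      rw [Complex.norm_exp_ofReal_mul_I, Complex.norm_exp_ofReal_mul_I]
      have hsq : (δ / 2) ^ 2 ≤ u ^ 2 := by
        rw [← sq_abs u]
        gcongr
      calc (1 + 1 : ℝ) = 4 / δ ^ 2 * 2 * (δ / 2) ^ 2 := by field_simp; norm_num
        _ ≤ 4 / δ ^ 2 * 2 * u ^ 2 := by gcongr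
        _ ≤ K * u ^ 2 := by
          rw [hK]
          gcongr
          exact le_add_of_nonneg_left (by positivity)
  refine (norm_sum_le _ _).trans ((Finset.sum_le_sum hpt).trans ?_)
  rw [← Finset.mul_sum]
  refine (mul_le_mul_of_nonneg_left (sum_binomialWeight_mul_sq_div_le (h0 n) hgn)
    (by positivity)).trans_eq ?_
  rw [hK]
  have hs : √(p n * (m n : ℝ)) * (1 / (p n * m n)) = (√(p n * (m n : ℝ)))⁻¹ := by
    nth_rewrite 2 [← Real.mul_self_sqrt hgn.le]
    have := (Real.sqrt_pos.2 hgn).ne'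
    field_simp
  rw [← hs]
  ring

end Asymptotics

lemma binomialWeight_pos {m j : ℕ} {p : ℝ} (h0 : 0 < p) (h1 : p < 1) (hj : j ≤ m) :
    0 < binomialWeight m p j := by
  have h2 : 0 < 1 - p := by linarith
  have h3 : (0 : ℝ) < m.choose j := by exact_mod_cast Nat.choose_pos hj
  unfold binomialWeight
  positivity

lemma choose_mul_exp_eq {m j : ℕ} (hj : j ≤ m) (b : ℝ) :
    (m.choose j : ℝ) * Real.exp (b * j) =
      binomialWeight m (Real.exp b / (1 + Real.exp b)) j * (1 + Real.exp b) ^ m := by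
  obtain ⟨l, rfl⟩ := Nat.exists_eq_add_of_le hj
  have h : (0 : ℝ) < 1 + Real.exp b := by positivity
  have hq : 1 - Real.exp b / (1 + Real.exp b) = 1 / (1 + Real.exp b) := by field_simp; ring
  rw [binomialWeight, hq, Nat.add_sub_cancel_left, mul_comm b, Real.exp_nat_mul, pow_add, div_pow,
    div_pow, one_pow]
  field_simp

section Product

variable {k : ℕ}

/-- The probability mass function of a vector of independent binomial variables. -/
noncomputable def productWeight (S : Fin k → ℕ) (p : Fin k → ℝ) (s : Fin k → ℕ) : ℝ :=
  ∏ ℓ, binomialWeight (S ℓ) (p ℓ) (s ℓ)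

/-- The set of vectors of natural numbers bounded by `S`. -/
def capBox (S : Fin k → ℕ) : Finset (Fin k → ℕ) :=
  Fintype.piFinset fun ℓ ↦ Finset.range (S ℓ + 1)

lemma mem_capBox {S s : Fin k → ℕ} : s ∈ capBox S ↔ ∀ ℓ, s ℓ ≤ S ℓ := by
  simp [capBox]

lemma sum_productWeight_mul (S : Fin k → ℕ) (p : Fin k → ℝ) (ℓ : Fin k) (g : ℕ → ℝ) :
    ∑ s ∈ capBox S, productWeight S p s * g (s ℓ) =
      ∑ j ∈ Finset.range (S ℓ + 1), binomialWeight (S ℓ) (p ℓ) j * g j := by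
  have h := Finset.prod_univ_sum (fun i ↦ Finset.range (S i + 1))
    (fun i j ↦ binomialWeight (S i) (p i) j * (if i = ℓ then g j else 1))
  simp only [Finset.prod_mul_distrib, Finset.prod_ite_eq', Finset.mem_univ, if_true] at h
  rw [capBox]
  simp only [productWeight]
  rw [← h, Finset.prod_eq_single ℓ]
  · simp
  · intro i _ hi
    simp [hi, sum_binomialWeight]
  · simp

lemma sum_productWeight (S : Fin k → ℕ) (p : Fin k → ℝ) :
    ∑ s ∈ capBox S, productWeight S p s = 1 := by
  have h := Finset.prod_univ_sum (fun i ↦ Finset.range (S i + 1))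
    (fun i j ↦ binomialWeight (S i) (p i) j)
  simp only [sum_binomialWeight, Finset.prod_const_one] at h
  exact h.symm

/-- Conditioning a finite probability vector on `A` changes the expectation of a function bounded
by `C` by at most `2 * C` times the mass of the complement of `A`. -/
lemma abs_sum_div_sub_sum_le {α : Type*} [DecidableEq α] {A B : Finset α} (hAB : A ⊆ B)
    {W g : α → ℝ} (hW : ∀ s ∈ B, 0 ≤ W s) (hW1 : ∑ s ∈ B, W s = 1) (hA : 0 < ∑ s ∈ A, W s)
    {C : ℝ} (hg : ∀ s, |g s| ≤ C) :
    |∑ s ∈ A, W s / (∑ s ∈ A, W s) * g s - ∑ s ∈ B, W s * g s| ≤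
      2 * C * (1 - ∑ s ∈ A, W s) := by
  set z := ∑ s ∈ A, W s with hz
  have hbound : ∀ D : Finset α, D ⊆ B → |∑ s ∈ D, W s * g s| ≤ C * ∑ s ∈ D, W s := by
    intro D hD
    refine (Finset.abs_sum_le_sum_abs _ _).trans ?_
    rw [Finset.mul_sum]
    refine Finset.sum_le_sum fun s hs ↦ ?_
    rw [abs_mul, abs_of_nonneg (hW s (hD hs)), mul_comm]
    exact mul_le_mul_of_nonneg_right (hg s) (hW s (hD hs))
  have h1 := Finset.sum_sdiff (f := W) hAB
  have h2 := Finset.sum_sdiff (f := fun s ↦ W s * g s) hAB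
  have hz1 : z ≤ 1 := by
    rw [← hW1]
    exact Finset.sum_le_sum_of_subset_of_nonneg hAB fun s hs _ ↦ hW s hs
  have e1 : ∑ s ∈ A, W s / z * g s = (∑ s ∈ A, W s * g s) / z := by
    rw [Finset.sum_div]
    exact Finset.sum_congr rfl fun s _ ↦ by ring
  have e2 : (∑ s ∈ A, W s * g s) / z - ∑ s ∈ B, W s * g s =
      (∑ s ∈ A, W s * g s) / z * (1 - z) - ∑ s ∈ B \ A, W s * g s := by
    rw [← h2]; field_simp; ring
  have b1 := hbound A hAB
  have b2 := hbound (B \ A) Finset.sdiff_subset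
  have b3 : |(∑ s ∈ A, W s * g s) / z * (1 - z)| ≤ C * (1 - z) := by
    rw [abs_mul, abs_of_nonneg (by linarith : 0 ≤ 1 - z), abs_div, abs_of_pos hA]
    refine mul_le_mul_of_nonneg_right ?_ (by linarith)
    rwa [div_le_iff₀ hA]
  have e3 : ∑ s ∈ B \ A, W s = 1 - z := by linarith
  rw [e3] at b2
  rw [e1, e2]
  refine (abs_sub _ _).trans ?_
  linarith

lemma one_sub_sum_productWeight_le {S : Fin k → ℕ} {p : Fin k → ℝ} (h0 : ∀ ℓ, 0 < p ℓ)
    (h1 : ∀ ℓ, p ℓ ≤ 1) (hS : ∀ ℓ, 0 < p ℓ * S ℓ) {A : Finset (Fin k → ℕ)} (hA : A ⊆ capBox S)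
    {ε : ℝ} (hε : 0 < ε)
    (hsub : ∀ s : Fin k → ℕ, (∀ ℓ, ⌊p ℓ * (S ℓ : ℝ) * (1 - ε)⌋₊ ≤ s ℓ ∧
      s ℓ ≤ ⌈p ℓ * (S ℓ : ℝ) * (1 + ε)⌉₊) → s ∈ A) :
    1 - ∑ s ∈ A, productWeight S p s ≤ ∑ ℓ, 1 / ε ^ 2 * (1 / (p ℓ * S ℓ)) := by
  classical
  have hW : ∀ s, 0 ≤ productWeight S p s := fun s ↦
    Finset.prod_nonneg fun ℓ _ ↦ binomialWeight_nonneg (h0 ℓ).le (h1 ℓ) _ _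
  let B : Fin k → ℕ → Prop := fun ℓ j ↦ ε ≤ |((j : ℝ) - S ℓ * p ℓ) / (S ℓ * p ℓ)|
  have hsplit := Finset.sum_sdiff (f := productWeight S p) hA
  rw [sum_productWeight] at hsplit
  calc 1 - ∑ s ∈ A, productWeight S p s = ∑ s ∈ capBox S \ A, productWeight S p s := by linarith
    _ ≤ ∑ s ∈ capBox S \ A, ∑ ℓ, productWeight S p s * (if B ℓ (s ℓ) then 1 else 0) := by
      refine Finset.sum_le_sum fun s hs ↦ ?_
      have hsA := (Finset.mem_sdiff.1 hs).2
      obtain ⟨ℓ, hℓ⟩ : ∃ ℓ, B ℓ (s ℓ) := by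
        by_contra! hno
        refine hsA (hsub s fun ℓ ↦ ?_)
        have hb := hno ℓ
        have hpos : (0 : ℝ) < S ℓ * p ℓ := by rw [mul_comm]; exact hS ℓ
        simp only [B, not_le] at hb
        rw [abs_div, abs_of_pos hpos, div_lt_iff₀ hpos, abs_lt] at hb
        constructor
        · exact Nat.floor_le_of_le (by linarith)
        · exact Nat.cast_le.1 (le_trans (by linarith) (Nat.le_ceil (p ℓ * (S ℓ : ℝ) * (1 + ε))))
      refine le_trans ?_ (Finset.single_le_sum (fun i _ ↦ mul_nonneg (hW s) ?_)
        (Finset.mem_univ ℓ))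
      · simp [hℓ]
      · split_ifs <;> norm_num
    _ ≤ ∑ s ∈ capBox S, ∑ ℓ, productWeight S p s * (if B ℓ (s ℓ) then 1 else 0) := by
      refine Finset.sum_le_sum_of_subset_of_nonneg Finset.sdiff_subset fun s _ _ ↦ ?_
      refine Finset.sum_nonneg fun i _ ↦ mul_nonneg (hW s) ?_
      split_ifs <;> norm_num
    _ = ∑ ℓ, ∑ j ∈ Finset.range (S ℓ + 1),
        binomialWeight (S ℓ) (p ℓ) j * (if B ℓ j then 1 else 0) := by
      rw [Finset.sum_comm]
      exact Finset.sum_congr rfl fun ℓ _ ↦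
        sum_productWeight_mul S p ℓ fun j ↦ if B ℓ j then 1 else 0
    _ ≤ _ := Finset.sum_le_sum fun ℓ _ ↦
      sum_binomialWeight_indicator_le (h0 ℓ) (h1 ℓ) (hS ℓ) hε fun _ h ↦ h

end Product

/-- Consistency and asymptotic normality of count SERGMs. For a
non-conflicted sequence of count SERGMs with caps `S̄^n → ∞`, parameters `β^n`
(with `p^n_ℓ = e^{β^n_ℓ}/(1+e^{β^n_ℓ})`, `p^n_ℓ S̄^n_ℓ → ∞`, `limsup p^n_ℓ < 1`),
the estimator `β̂^n_ℓ = log(S^n_ℓ/(S̄^n_ℓ − S^n_ℓ))` satisfies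
(a) `max_ℓ |β̂^n_ℓ − β^n_ℓ| → 0` in probability, and
(b) `√(S̄^n_ℓ p^n_ℓ (1−p^n_ℓ))·(β̂^n_ℓ − β^n_ℓ)` converges in distribution to the
standard Gaussian (tested against every bounded continuous function). -/
theorem stmt_5 (k : ℕ)
    (Sbar : ℕ → Fin k → ℕ)
    (hSbar : ∀ ℓ, Tendsto (fun n => Sbar n ℓ) atTop atTop)
    (A : ℕ → Finset (Fin k → ℕ)) (hAne : ∀ n, (A n).Nonempty)
    (hA : ∀ n, ∀ s ∈ A n, ∀ ℓ, s ℓ ≤ Sbar n ℓ)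
    (β : ℕ → Fin k → ℝ) (p : ℕ → Fin k → ℝ)
    (hp : ∀ n ℓ, p n ℓ = Real.exp (β n ℓ) / (1 + Real.exp (β n ℓ)))
    (hnonconf : ∃ ε : ℝ, 0 < ε ∧ ε < 1 ∧ ∃ N : ℕ, ∀ n ≥ N,
      ∀ s : Fin k → ℕ,
        (∀ ℓ, ⌊p n ℓ * (Sbar n ℓ : ℝ) * (1 - ε)⌋₊ ≤ s ℓ ∧
          s ℓ ≤ ⌈p n ℓ * (Sbar n ℓ : ℝ) * (1 + ε)⌉₊) → s ∈ A n)
    (hgrow : ∀ ℓ, Tendsto (fun n => p n ℓ * (Sbar n ℓ : ℝ)) atTop atTop)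
    (hlimsup : ∀ ℓ, Filter.limsup (fun n => p n ℓ) atTop < 1)
    (P : ℕ → (Fin k → ℕ) → ℝ)
    (hP : ∀ n s, P n s =
      ((∏ ℓ, ((Sbar n ℓ).choose (s ℓ) : ℝ)) * Real.exp (∑ ℓ, β n ℓ * (s ℓ : ℝ))) /
        ∑ s' ∈ A n, (∏ ℓ, ((Sbar n ℓ).choose (s' ℓ) : ℝ)) *
          Real.exp (∑ ℓ, β n ℓ * (s' ℓ : ℝ)))
    (bhat : ℕ → (Fin k → ℕ) → Fin k → ℝ)
    (hbhat : ∀ n s ℓ, bhat n s ℓ =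
      if 0 < s ℓ ∧ s ℓ < Sbar n ℓ then
        Real.log ((s ℓ : ℝ) / ((Sbar n ℓ : ℝ) - (s ℓ : ℝ)))
      else 0) :
    (∀ ε : ℝ, 0 < ε →
      Tendsto (fun n => ∑ s ∈ A n,
        Set.indicator {s' : Fin k → ℕ | ∃ ℓ, ε < |bhat n s' ℓ - β n ℓ|} (P n) s)
        atTop (nhds 0)) ∧
    (∀ ℓ : Fin k, ∀ f : ℝ → ℝ, Continuous f → (∃ C : ℝ, ∀ x, |f x| ≤ C) →
      Tendsto (fun n => ∑ s ∈ A n, P n s *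
          f (Real.sqrt ((Sbar n ℓ : ℝ) * p n ℓ * (1 - p n ℓ)) * (bhat n s ℓ - β n ℓ)))
        atTop (nhds (∫ x, f x ∂(ProbabilityTheory.gaussianReal 0 1)))) := by
  classical
  have hp0 : ∀ n ℓ, 0 < p n ℓ := fun n ℓ ↦ by rw [hp]; positivity
  have hp1 : ∀ n ℓ, p n ℓ < 1 := fun n ℓ ↦ by
    rw [hp, div_lt_one (by positivity)]
    linarith
  have hlogit : ∀ n ℓ, β n ℓ = Real.log (p n ℓ / (1 - p n ℓ)) := fun n ℓ ↦ by
    have h : (0 : ℝ) < 1 + Real.exp (β n ℓ) := by positivity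
    have h2 : p n ℓ / (1 - p n ℓ) = Real.exp (β n ℓ) := by rw [hp]; field_simp; simp
    rw [h2, Real.log_exp]
  have hδ : ∀ ℓ, ∃ δ : ℝ, 0 < δ ∧ ∀ᶠ n in atTop, p n ℓ ≤ 1 - δ := fun ℓ ↦ by
    obtain ⟨c, hc, hc1⟩ := exists_between (hlimsup ℓ)
    refine ⟨1 - c, by linarith, ?_⟩
    filter_upwards [eventually_lt_of_limsup_lt hc
      (isBoundedUnder_of ⟨1, fun n ↦ (hp1 n ℓ).le⟩)] with n hn
    linarith
  have hsub : ∀ n, A n ⊆ capBox (Sbar n) := fun n s hs ↦ mem_capBox.2 (hA n s hs)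
  have hWpos : ∀ n, ∀ s ∈ capBox (Sbar n), 0 < productWeight (Sbar n) (p n) s := fun n s hs ↦
    Finset.prod_pos fun ℓ _ ↦ binomialWeight_pos (hp0 n ℓ) (hp1 n ℓ) (mem_capBox.1 hs ℓ)
  have hWA : ∀ n, 0 < ∑ s ∈ A n, productWeight (Sbar n) (p n) s := fun n ↦
    Finset.sum_pos (fun s hs ↦ hWpos n s (hsub n hs)) (hAne n)
  have hPW : ∀ n, ∀ s ∈ A n, P n s =
      productWeight (Sbar n) (p n) s / ∑ s' ∈ A n, productWeight (Sbar n) (p n) s' := by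
    intro n s hs
    have hT : ∀ s ∈ A n, (∏ ℓ, ((Sbar n ℓ).choose (s ℓ) : ℝ)) *
        Real.exp (∑ ℓ, β n ℓ * (s ℓ : ℝ)) =
        productWeight (Sbar n) (p n) s * ∏ ℓ, (1 + Real.exp (β n ℓ)) ^ Sbar n ℓ := by
      intro s hs
      rw [Real.exp_sum, ← Finset.prod_mul_distrib, productWeight, ← Finset.prod_mul_distrib]
      exact Finset.prod_congr rfl fun ℓ _ ↦ by rw [choose_mul_exp_eq (hA n s hs ℓ), hp]
    rw [hP, hT s hs, Finset.sum_congr rfl hT, ← Finset.sum_mul, mul_div_mul_right]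
    exact (Finset.prod_pos fun ℓ _ ↦ by positivity).ne'
  obtain ⟨ε₀, hε₀, -, N, hN⟩ := hnonconf
  have hmass : Tendsto (fun n ↦ 1 - ∑ s ∈ A n, productWeight (Sbar n) (p n) s) atTop
      (nhds 0) := by
    have hlim : Tendsto (fun n ↦ ∑ ℓ, 1 / ε₀ ^ 2 * (1 / (p n ℓ * Sbar n ℓ))) atTop (nhds 0) := by
      rw [show nhds (0 : ℝ) = nhds (∑ _ℓ : Fin k, (0 : ℝ)) by simp]
      refine tendsto_finsetSum _ fun ℓ _ ↦ ?_
      have := (tendsto_inv_atTop_zero.comp (hgrow ℓ)).const_mul (1 / ε₀ ^ 2)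
      rw [mul_zero] at this
      simpa only [one_div, Function.comp_def] using this
    refine squeeze_zero' (.of_forall fun n ↦ ?_) ?_ hlim
    · rw [sub_nonneg, ← sum_productWeight (Sbar n) (p n)]
      exact Finset.sum_le_sum_of_subset_of_nonneg (hsub n) fun s hs _ ↦ (hWpos n s hs).le
    · filter_upwards [eventually_ge_atTop N,
        eventually_all.2 fun ℓ ↦ (hgrow ℓ).eventually_gt_atTop 0] with n hn hg
      exact one_sub_sum_productWeight_le (hp0 n) (fun ℓ ↦ (hp1 n ℓ).le) hg (hsub n) hε₀ (hN n hn)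
  have htransfer : ∀ (ℓ : Fin k) (g : ℕ → ℕ → ℝ) (C L : ℝ), (∀ n j, |g n j| ≤ C) →
      Tendsto (fun n ↦ ∑ j ∈ Finset.range (Sbar n ℓ + 1),
        binomialWeight (Sbar n ℓ) (p n ℓ) j * g n j) atTop (nhds L) →
      Tendsto (fun n ↦ ∑ s ∈ A n, P n s * g n (s ℓ)) atTop (nhds L) := by
    intro ℓ g C L hg hL
    have hd : Tendsto (fun n ↦ ∑ s ∈ A n, P n s * g n (s ℓ) -
        ∑ j ∈ Finset.range (Sbar n ℓ + 1),
          binomialWeight (Sbar n ℓ) (p n ℓ) j * g n j) atTop (nhds 0) := by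
      refine squeeze_zero_norm (fun n ↦ ?_) (by simpa using hmass.const_mul (2 * C))
      rw [← sum_productWeight_mul (Sbar n) (p n) ℓ (g n), Real.norm_eq_abs,
        Finset.sum_congr rfl fun s hs ↦ by rw [hPW n s hs]]
      exact abs_sum_div_sub_sum_le (g := fun s ↦ g n (s ℓ)) (hsub n)
        (fun s hs ↦ (hWpos n s hs).le)
        (sum_productWeight _ _) (hWA n) fun s ↦ hg n (s ℓ)
    simpa using hd.add hL
  have hbl : ∀ n s ℓ, bhat n s ℓ = logOdds (Sbar n ℓ) (s ℓ) := fun n s ℓ ↦ by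
    rw [hbhat, logOdds]
  have hPnonneg : ∀ n, ∀ s ∈ A n, 0 ≤ P n s := fun n s hs ↦ by
    rw [hPW n s hs]
    exact div_nonneg (hWpos n s (hsub n hs)).le (hWA n).le
  refine ⟨fun ε hε ↦ ?_, fun ℓ f hf ⟨C, hC⟩ ↦ ?_⟩
  · have hlim : Tendsto (fun n ↦ ∑ ℓ, ∑ s ∈ A n, P n s *
        (if ε < |logOdds (Sbar n ℓ) (s ℓ) - Real.log (p n ℓ / (1 - p n ℓ))| then 1 else 0))
        atTop (nhds 0) := by
      rw [show nhds (0 : ℝ) = nhds (∑ _ℓ : Fin k, (0 : ℝ)) by simp]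
      refine tendsto_finsetSum _ fun ℓ _ ↦ ?_
      obtain ⟨δ, hδ0, hδp⟩ := hδ ℓ
      refine htransfer ℓ (fun n j ↦
        if ε < |logOdds (Sbar n ℓ) j - Real.log (p n ℓ / (1 - p n ℓ))| then 1 else 0) 1 0
        (fun n j ↦ ?_) ?_
      · split_ifs <;> simp
      · exact tendsto_sum_binomialWeight_logOdds_deviation (fun n ↦ hp0 n ℓ) hδ0 hδp (hgrow ℓ) hε
    refine squeeze_zero (fun n ↦ ?_) (fun n ↦ ?_) hlim
    · exact Finset.sum_nonneg fun s hs ↦ Set.indicator_apply_nonneg fun _ ↦ hPnonneg n s hs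
    · rw [Finset.sum_comm]
      refine Finset.sum_le_sum fun s hs ↦ ?_
      have hterm : ∀ ℓ ∈ Finset.univ, 0 ≤ P n s *
          (if ε < |logOdds (Sbar n ℓ) (s ℓ) - Real.log (p n ℓ / (1 - p n ℓ))| then
            (1 : ℝ) else 0) := fun ℓ _ ↦ by
        refine mul_nonneg (hPnonneg n s hs) ?_
        split_ifs <;> norm_num
      refine Set.indicator_apply_le' ?_ fun _ ↦ Finset.sum_nonneg hterm
      rintro ⟨ℓ, hℓ⟩
      refine le_trans ?_ (Finset.single_le_sum hterm (Finset.mem_univ ℓ))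
      rw [hbl, hlogit n ℓ] at hℓ
      rw [if_pos hℓ, mul_one]
  · obtain ⟨δ, hδ0, hδp⟩ := hδ ℓ
    simp_rw [hbl, hlogit]
    exact htransfer ℓ (fun n j ↦ f (√((Sbar n ℓ : ℝ) * p n ℓ * (1 - p n ℓ)) *
      (logOdds (Sbar n ℓ) j - Real.log (p n ℓ / (1 - p n ℓ))))) C _ (fun n j ↦ hC _)
      (tendsto_sum_binomialWeight_logOdds (fun n ↦ hp0 n ℓ) (fun n ↦ hp1 n ℓ) hδ0 hδp
        (hgrow ℓ) hf hC)
end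

section
/- Let ι be a finite type (the set of potential subgraphs), c : ι → {1,…,k} a classification into k types, and θ ∈ ℝ^k. Suppose the indicators {X_i}_{i∈ι} are independent with P(X_i = 1) = exp(θ_{c(i)}) / (exp(θ_{c(i)}) + 1) and P(X_i = 0) = 1/(exp(θ_{c(i)}) + 1). Let S̄_ℓ = #{ i ∈ ι : c(i) = ℓ } and let S̃ ∈ ℕ^k be the random count vector S̃_ℓ = #{ i : c(i) = ℓ and X_i = 1 }. Then for every s with 0 ≤ s_ℓ ≤ S̄_ℓ for all ℓ: P( S̃ = s ) = [ ∏_{ℓ=1}^k binom(S̄_ℓ, s_ℓ) ] · exp(⟨θ,s⟩) / Σ_{s' : 0 ≤ s'_ℓ ≤ S̄_ℓ ∀ℓ} [ ∏_{ℓ=1}^k binom(S̄_ℓ, s'_ℓ) ] · exp(⟨θ,s'⟩). That is, a SUGM whose type-ℓ subgraphs each form independently with probability e^{θ_ℓ}/(e^{θ_ℓ}+1) has count vector distributed as the SERGM with binomial-coefficient weights and parameter θ. -/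
open scoped Classical

/-- The number of binary configurations with a prescribed count `s ℓ` of selected points of each
type `ℓ` is a product of binomial coefficients. -/
theorem card_filter_typeCount_eq {ι κ : Type*} [Fintype ι] [Fintype κ] (c : ι → κ) (s : κ → ℕ) :
    (Finset.univ.filter (fun ω : ι → Bool =>
      ∀ ℓ, (Finset.univ.filter (fun i => c i = ℓ ∧ ω i = true)).card = s ℓ)).card =
      ∏ ℓ, ((Finset.univ.filter (fun i => c i = ℓ)).card).choose (s ℓ) := by
  simp_rw [← Finset.card_powersetCard]
  rw [← Fintype.card_piFinset]
  refine Finset.card_bij'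
    (fun ω _ ℓ => Finset.univ.filter (fun i => c i = ℓ ∧ ω i = true))
    (fun f _ i => decide (i ∈ f (c i))) ?_ ?_ ?_ ?_
  · intro ω hω
    simp only [Finset.mem_filter, Finset.mem_univ, true_and] at hω
    simp only [Fintype.mem_piFinset, Finset.mem_powersetCard]
    exact fun ℓ => ⟨fun i hi => by simp_all, hω ℓ⟩
  · intro f hf
    simp only [Fintype.mem_piFinset, Finset.mem_powersetCard] at hf
    simp only [Finset.mem_filter, Finset.mem_univ, true_and, decide_eq_true_eq]
    intro ℓ
    rw [← (hf ℓ).2]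
    congr 1
    ext i
    have := @(hf ℓ).1 i
    simp only [Finset.mem_filter, Finset.mem_univ, true_and] at this ⊢
    exact ⟨fun h => h.1 ▸ h.2, fun h => ⟨this h, (this h).symm ▸ h⟩⟩
  · intro ω _
    ext i
    simp
  · intro f hf
    simp only [Fintype.mem_piFinset, Finset.mem_powersetCard] at hf
    ext ℓ i
    have := @(hf ℓ).1 i
    simp only [Finset.mem_filter, Finset.mem_univ, true_and, decide_eq_true_eq] at this ⊢
    exact ⟨fun h => h.1 ▸ h.2, fun h => ⟨this h, (this h).symm ▸ h⟩⟩

/-- The probability of a configuration of independent logistic indicators depends only on the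
type counts. -/
theorem prod_logistic_eq_exp_div {ι κ : Type*} [Fintype ι] [Fintype κ] (c : ι → κ) (θ : κ → ℝ)
    (ω : ι → Bool) :
    ∏ i, (if ω i then Real.exp (θ (c i)) / (Real.exp (θ (c i)) + 1)
        else 1 / (Real.exp (θ (c i)) + 1)) =
      Real.exp (∑ ℓ, θ ℓ * ((Finset.univ.filter (fun i => c i = ℓ ∧ ω i = true)).card : ℝ)) /
        ∏ i, (Real.exp (θ (c i)) + 1) := by
  have hsum : ∑ ℓ, θ ℓ * ((Finset.univ.filter (fun i => c i = ℓ ∧ ω i = true)).card : ℝ) =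
      ∑ i, if ω i then θ (c i) else 0 := by
    rw [← Finset.sum_fiberwise (s := Finset.univ) (g := c)]
    refine Finset.sum_congr rfl fun ℓ _ => ?_
    rw [← Finset.sum_filter, Finset.filter_filter,
      Finset.sum_congr rfl (g := fun _ => θ ℓ) (by intro i hi; simp_all)]
    rw [Finset.sum_const, nsmul_eq_mul, mul_comm]
  rw [hsum, Real.exp_sum, ← Finset.prod_div_distrib]
  refine Finset.prod_congr rfl fun i _ => ?_
  split_ifs <;> simp

/-- The normalizing constant of the SERGM with binomial weights. -/
theorem sum_choose_mul_exp_eq_prod {ι κ : Type*} [Fintype ι] [Fintype κ] [DecidableEq κ]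
    (c : ι → κ) (θ : κ → ℝ) (n : κ → ℕ)
    (hn : ∀ ℓ, n ℓ = (Finset.univ.filter (fun i => c i = ℓ)).card) :
    ∑ s ∈ Fintype.piFinset (fun ℓ => Finset.range (n ℓ + 1)),
        (∏ ℓ, ((n ℓ).choose (s ℓ) : ℝ)) * Real.exp (∑ ℓ, θ ℓ * (s ℓ : ℝ)) =
      ∏ i, (Real.exp (θ (c i)) + 1) := by
  simp_rw [Real.exp_sum, ← Finset.prod_mul_distrib]
  rw [← Finset.prod_univ_sum (fun ℓ => Finset.range (n ℓ + 1))
      (fun ℓ j => ((n ℓ).choose j : ℝ) * Real.exp (θ ℓ * (j : ℝ))),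
    ← Finset.prod_fiberwise (s := Finset.univ) (g := c)]
  refine Finset.prod_congr rfl fun ℓ _ => ?_
  rw [Finset.prod_congr rfl (g := fun _ => Real.exp (θ ℓ) + 1) (by intro i hi; simp_all),
    Finset.prod_const, ← hn, add_pow]
  refine Finset.sum_congr rfl fun j _ => ?_
  rw [one_pow, mul_one, mul_comm (θ ℓ), Real.exp_nat_mul, mul_comm]

/-- SERGM representation of a SUGM. If each potential subgraph `i` of
type `c i` forms independently with probability `e^{θ_{c i}}/(e^{θ_{c i}}+1)`, then
the vector of counts of truly generated subgraphs of each type is distributed as the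
SERGM with binomial-coefficient weights `K(s) = ∏_ℓ binom(S̄_ℓ, s_ℓ)` and
parameter `θ`. -/
theorem stmt_9 (ι : Type) [Fintype ι] [DecidableEq ι] (k : ℕ)
    (c : ι → Fin k) (θ : Fin k → ℝ)
    (prob : (ι → Bool) → ℝ)
    (hprob : ∀ ω, prob ω =
      ∏ i, (if ω i then Real.exp (θ (c i)) / (Real.exp (θ (c i)) + 1)
            else 1 / (Real.exp (θ (c i)) + 1)))
    (Sbar : Fin k → ℕ)
    (hSbar : ∀ ℓ, Sbar ℓ = (Finset.univ.filter (fun i => c i = ℓ)).card)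
    (count : (ι → Bool) → Fin k → ℕ)
    (hcount : ∀ ω ℓ, count ω ℓ =
      (Finset.univ.filter (fun i => c i = ℓ ∧ ω i = true)).card) :
    ∀ s : Fin k → ℕ, (∀ ℓ, s ℓ ≤ Sbar ℓ) →
      ∑ ω ∈ Finset.univ.filter (fun ω : ι → Bool => count ω = s), prob ω =
        ((∏ ℓ, ((Sbar ℓ).choose (s ℓ) : ℝ)) * Real.exp (∑ ℓ, θ ℓ * (s ℓ : ℝ))) /
          ∑ s' ∈ Fintype.piFinset (fun ℓ => Finset.range (Sbar ℓ + 1)),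
            (∏ ℓ, ((Sbar ℓ).choose (s' ℓ) : ℝ)) * Real.exp (∑ ℓ, θ ℓ * (s' ℓ : ℝ)) := by
  intro s _
  rw [sum_choose_mul_exp_eq_prod c θ Sbar hSbar]
  have hfilter : Finset.univ.filter (fun ω : ι → Bool => count ω = s) =
      Finset.univ.filter (fun ω : ι → Bool =>
        ∀ ℓ, (Finset.univ.filter (fun i => c i = ℓ ∧ ω i = true)).card = s ℓ) := by
    ext ω
    simp [funext_iff, hcount]
  have hconst : ∀ ω ∈ Finset.univ.filter (fun ω : ι → Bool => count ω = s), prob ω =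
      Real.exp (∑ ℓ, θ ℓ * (s ℓ : ℝ)) / ∏ i, (Real.exp (θ (c i)) + 1) := by
    intro ω hω
    obtain rfl : count ω = s := (Finset.mem_filter.mp hω).2
    simp only [hprob, hcount]
    convert prod_logistic_eq_exp_div c θ ω
  have hcard : (Finset.univ.filter (fun ω : ι → Bool => count ω = s)).card =
      ∏ ℓ, (Sbar ℓ).choose (s ℓ) := by
    rw [hfilter]
    simp only [hSbar]
    convert card_filter_typeCount_eq c s
  rw [Finset.sum_congr rfl hconst, Finset.sum_const, hcard, nsmul_eq_mul, Nat.cast_prod,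
    mul_div_assoc]
end

section
/- Fix n ∈ ℕ and identify graphs on vertex set V = {1,…,n} with finite sets of unordered pairs of distinct vertices (edges). Let 𝒢 be a finite set of nonempty graphs on V and v : 𝒢 → ℝ. Define u_i(g) = Σ_{h∈𝒢ᵢ(g)} v(h), where 𝒢ᵢ(g) = { h ∈ 𝒢 : h ⊆ g and i is incident to some edge of h }, and define f(g) = Σ_{h∈𝒢, h⊆g} 2·v(h). Then f is an exact potential for pairwise deviations: for every graph g and every edge {i,j} ∈ g, f(g) − f(g \ {i,j}) = ( u_i(g) + u_j(g) ) − ( u_i(g \ {i,j}) + u_j(g \ {i,j}) ). -/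
open scoped Classical

/-- Agent `i`'s utility from network `g`: the sum of `v h` over payoff-relevant
subgraphs `h ∈ G` with `h ⊆ g` such that `i` is incident to some edge of `h`. -/
noncomputable def uGraph (n : ℕ) (G : Finset (Finset (Sym2 (Fin n))))
    (v : Finset (Sym2 (Fin n)) → ℝ) (i : Fin n) (g : Finset (Sym2 (Fin n))) : ℝ :=
  ∑ h ∈ G.filter (fun h => h ⊆ g ∧ ∃ e ∈ h, i ∈ e), v h

/-- The potential function `f(g) = Σ_{h∈G, h⊆g} 2·v(h)`. -/
noncomputable def fPotential (n : ℕ) (G : Finset (Finset (Sym2 (Fin n))))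
    (v : Finset (Sym2 (Fin n)) → ℝ) (g : Finset (Sym2 (Fin n))) : ℝ :=
  ∑ h ∈ G.filter (fun h => h ⊆ g), 2 * v h

/-- Deleting an edge `e` at `k` costs `k` the value of the subgraphs containing `e`. -/
theorem uGraph_sub_uGraph_erase (n : ℕ) (G : Finset (Finset (Sym2 (Fin n))))
    (v : Finset (Sym2 (Fin n)) → ℝ) {k : Fin n} {e : Sym2 (Fin n)} (hk : k ∈ e)
    (g : Finset (Sym2 (Fin n))) :
    uGraph n G v k g - uGraph n G v k (g.erase e) =
      ∑ h ∈ G.filter (fun h => h ⊆ g ∧ e ∈ h), v h := by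
  simp only [uGraph, Finset.sum_filter, ← Finset.sum_sub_distrib, Finset.subset_erase]
  refine Finset.sum_congr rfl fun h _ => ?_
  by_cases heh : e ∈ h
  · have hinc : ∃ e ∈ h, k ∈ e := ⟨e, heh, hk⟩
    simp [heh, hinc]
  · simp [heh]

/-- Deleting an edge `e` lowers the potential by twice the value of the subgraphs
containing `e`. -/
theorem fPotential_sub_fPotential_erase (n : ℕ) (G : Finset (Finset (Sym2 (Fin n))))
    (v : Finset (Sym2 (Fin n)) → ℝ) (e : Sym2 (Fin n)) (g : Finset (Sym2 (Fin n))) :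
    fPotential n G v g - fPotential n G v (g.erase e) =
      2 * ∑ h ∈ G.filter (fun h => h ⊆ g ∧ e ∈ h), v h := by
  simp only [fPotential, Finset.mul_sum, Finset.sum_filter, ← Finset.sum_sub_distrib,
    Finset.subset_erase]
  refine Finset.sum_congr rfl fun h _ => ?_
  by_cases heh : e ∈ h <;> simp [heh]

/-- `f` is an exact potential for pairwise deviations: for every graph
`g` (a set of edges, i.e. unordered pairs of distinct vertices) and every edge
`{i,j} ∈ g`, `f(g) − f(g∖{i,j}) = (u_i(g)+u_j(g)) − (u_i(g∖{i,j})+u_j(g∖{i,j}))`. -/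
theorem stmt_15 (n : ℕ) (G : Finset (Finset (Sym2 (Fin n))))
    (hG : ∀ h ∈ G, h.Nonempty ∧ ∀ e ∈ h, ¬ e.IsDiag)
    (v : Finset (Sym2 (Fin n)) → ℝ)
    (g : Finset (Sym2 (Fin n))) (hg : ∀ e ∈ g, ¬ e.IsDiag)
    (i j : Fin n) (hij : i ≠ j) (he : s(i, j) ∈ g) :
    fPotential n G v g - fPotential n G v (g.erase s(i, j)) =
      (uGraph n G v i g + uGraph n G v j g) -
        (uGraph n G v i (g.erase s(i, j)) + uGraph n G v j (g.erase s(i, j))) := by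
  have hi := uGraph_sub_uGraph_erase n G v (Sym2.mem_mk_left i j) g
  have hj := uGraph_sub_uGraph_erase n G v (Sym2.mem_mk_right i j) g
  linarith [fPotential_sub_fPotential_erase n G v s(i, j) g]
end

section
/- Fix n ∈ ℕ and identify graphs on vertex set V = {1,…,n} with finite sets of unordered pairs of distinct vertices (edges). Let 𝒢 be a finite set of nonempty graphs on V and v : 𝒢 → ℝ, with u_i(g) = Σ_{h∈𝒢, h⊆g, i incident to an edge of h} v(h) and f(g) = Σ_{h∈𝒢, h⊆g} 2·v(h). If g* maximizes f over all graphs on V, then g* is pairwise stable with transfers: for every edge {i,j} ∈ g*, u_i(g*) + u_j(g*) ≥ u_i(g* \ {i,j}) + u_j(g* \ {i,j}), and for every pair {i,j} ∉ g*, u_i(g*) + u_j(g*) ≥ u_i(g* ∪ {i,j}) + u_j(g* ∪ {i,j}). In particular, a pairwise stable with transfers network exists. -/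
open scoped Classical

/-- `g` is pairwise stable with transfers: no pair jointly gains (in summed
utility) from deleting an existing link between them or adding a missing one. -/
def PairwiseStableWithTransfers (n : ℕ) (G : Finset (Finset (Sym2 (Fin n))))
    (v : Finset (Sym2 (Fin n)) → ℝ) (g : Finset (Sym2 (Fin n))) : Prop :=
  (∀ i j : Fin n, i ≠ j → s(i, j) ∈ g →
    uGraph n G v i (g.erase s(i, j)) + uGraph n G v j (g.erase s(i, j)) ≤
      uGraph n G v i g + uGraph n G v j g) ∧
  (∀ i j : Fin n, i ≠ j → s(i, j) ∉ g →
    uGraph n G v i (insert s(i, j) g) + uGraph n G v j (insert s(i, j) g) ≤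
      uGraph n G v i g + uGraph n G v j g)

/-- Deleting the link between `i` and `j` changes their summed utility and the potential by the
same amount. -/
theorem uGraph_add_uGraph_sub_fPotential_erase (n : ℕ) (G : Finset (Finset (Sym2 (Fin n))))
    (v : Finset (Sym2 (Fin n)) → ℝ) (i j : Fin n) (g : Finset (Sym2 (Fin n))) :
    uGraph n G v i (g.erase s(i, j)) + uGraph n G v j (g.erase s(i, j)) -
        fPotential n G v (g.erase s(i, j)) =
      uGraph n G v i g + uGraph n G v j g - fPotential n G v g := by
  simp only [uGraph, fPotential, Finset.sum_filter, ← Finset.sum_add_distrib,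
    ← Finset.sum_sub_distrib]
  refine Finset.sum_congr rfl fun h _ => ?_
  by_cases he : s(i, j) ∈ h
  · have hi : ∃ e ∈ h, i ∈ e := ⟨_, he, Sym2.mem_mk_left i j⟩
    have hj : ∃ e ∈ h, j ∈ e := ⟨_, he, Sym2.mem_mk_right i j⟩
    simp only [hi, hj, and_true]
    split_ifs <;> ring
  · have hsub : h ⊆ g.erase s(i, j) ↔ h ⊆ g := by
      simp [Finset.subset_erase, he]
    simp only [hsub]

/-- A maximizer `g*` of the potential `f` over all graphs on `V`
(sets of unordered pairs of distinct vertices) is pairwise stable with transfers;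
in particular, a pairwise stable with transfers network exists. -/
theorem stmt_16 (n : ℕ) (G : Finset (Finset (Sym2 (Fin n))))
    (hG : ∀ h ∈ G, h.Nonempty ∧ ∀ e ∈ h, ¬ e.IsDiag)
    (v : Finset (Sym2 (Fin n)) → ℝ)
    (gstar : Finset (Sym2 (Fin n))) (hgstar : ∀ e ∈ gstar, ¬ e.IsDiag)
    (hmax : ∀ g : Finset (Sym2 (Fin n)), (∀ e ∈ g, ¬ e.IsDiag) →
      fPotential n G v g ≤ fPotential n G v gstar) :
    PairwiseStableWithTransfers n G v gstar ∧
      ∃ g : Finset (Sym2 (Fin n)), (∀ e ∈ g, ¬ e.IsDiag) ∧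
        PairwiseStableWithTransfers n G v g := by
  have hstable : PairwiseStableWithTransfers n G v gstar := by
    refine ⟨fun i j _ _ => ?_, fun i j hij hmem => ?_⟩
    · have h := uGraph_add_uGraph_sub_fPotential_erase n G v i j gstar
      have hle := hmax (gstar.erase s(i, j)) fun e he => hgstar e (Finset.mem_of_mem_erase he)
      linarith
    · have h := uGraph_add_uGraph_sub_fPotential_erase n G v i j (insert s(i, j) gstar)
      rw [Finset.erase_insert hmem] at h
      have hle := hmax (insert s(i, j) gstar) fun e he => by
        rcases Finset.mem_insert.mp he with rfl | he
        · simpa using hij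
        · exact hgstar e he
      linarith
  exact ⟨hstable, gstar, hgstar, hstable⟩
end

section
/- Fix n ∈ ℕ and identify graphs on vertex set V = {1,…,n} with finite sets of unordered pairs of distinct vertices (edges). Let 𝒢 be a finite set of nonempty graphs on V and v : 𝒢 → ℝ, with u_i(g) = Σ_{h∈𝒢, h⊆g, i incident to an edge of h} v(h) and f(g) = Σ_{h∈𝒢, h⊆g} 2·v(h). Define the Gibbs distribution π(g) = exp(f(g)) / Σ_{g'} exp(f(g')), where the sum is over all graphs on V. For any graph h with {i,j} ∉ h, set g⁺ = h ∪ {{i,j}}, g⁻ = h, U⁺ = u_i(g⁺) + u_j(g⁺), U⁻ = u_i(g⁻) + u_j(g⁻), and let p ≥ 0 be any recognition probability depending only on h. Then detailed balance holds for the logistic link-updating dynamics: π(g⁻) · p · exp(U⁺)/(exp(U⁺) + exp(U⁻)) = π(g⁺) · p · exp(U⁻)/(exp(U⁺) + exp(U⁻)). Hence π is a reversible (and thus stationary) distribution for the Markov chain in which, upon recognition of a pair {i,j}, the link is added/kept with probability exp(U⁺)/(exp(U⁺)+exp(U⁻)) and otherwise deleted/left absent. -/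
open scoped Classical

/-- Any sum over members of `G` that lie below a graph splits, on adding the edge `e`, into the old
sum and the sum over the subgraphs that use `e`. -/
theorem sum_filter_subset_insert {α : Type*} [DecidableEq α] (G : Finset (Finset α)) (w : Finset α → ℝ)
    {e : α} {g : Finset α} (he : e ∉ g) :
    ∑ k ∈ G.filter (fun k => k ⊆ insert e g), w k =
      ∑ k ∈ G.filter (fun k => k ⊆ g), w k +
        ∑ k ∈ G.filter (fun k => e ∈ k ∧ k ⊆ insert e g), w k := by
  simp only [Finset.sum_filter, ← Finset.sum_add_distrib]
  refine Finset.sum_congr rfl fun k _ => ?_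
  by_cases hek : e ∈ k
  · have hkg : ¬ k ⊆ g := fun hk => he (hk hek)
    simp [hek, hkg]
  · simp [hek, Finset.subset_insert_iff_of_notMem hek]

/-- The marginal utility of a link to one of its endpoints. -/
theorem uGraph_insert (n : ℕ) (G : Finset (Finset (Sym2 (Fin n))))
    (v : Finset (Sym2 (Fin n)) → ℝ) {i : Fin n} {e : Sym2 (Fin n)} {g : Finset (Sym2 (Fin n))}
    (hi : i ∈ e) (he : e ∉ g) :
    uGraph n G v i (insert e g) = uGraph n G v i g +
      ∑ k ∈ G.filter (fun k => e ∈ k ∧ k ⊆ insert e g), v k := by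
  have key := sum_filter_subset_insert (G.filter fun k => ∃ e ∈ k, i ∈ e) v he
  have hnew : (G.filter fun k => ∃ e ∈ k, i ∈ e).filter (fun k => e ∈ k ∧ k ⊆ insert e g) =
      G.filter (fun k => e ∈ k ∧ k ⊆ insert e g) := by
    ext k
    simp only [Finset.mem_filter]
    exact ⟨fun hk => ⟨hk.1.1, hk.2⟩, fun hk => ⟨⟨hk.1, e, hk.2.1, hi⟩, hk.2⟩⟩
  have hu : ∀ g', uGraph n G v i g' =
      ∑ k ∈ (G.filter fun k => ∃ e ∈ k, i ∈ e).filter (fun k => k ⊆ g'), v k := fun g' => by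
    refine Finset.sum_congr ?_ fun _ _ => rfl
    ext k
    simp only [Finset.mem_filter]
    tauto
  rw [hu, hu, key, hnew]

/-- `fPotential` is a potential for the joint utility of the endpoints of a link. -/
theorem fPotential_insert_add (n : ℕ) (G : Finset (Finset (Sym2 (Fin n))))
    (v : Finset (Sym2 (Fin n)) → ℝ) (i j : Fin n) {g : Finset (Sym2 (Fin n))}
    (he : s(i, j) ∉ g) :
    fPotential n G v (insert s(i, j) g) + (uGraph n G v i g + uGraph n G v j g) =
      fPotential n G v g +
        (uGraph n G v i (insert s(i, j) g) + uGraph n G v j (insert s(i, j) g)) := by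
  rw [uGraph_insert n G v (Sym2.mem_mk_left i j) he, uGraph_insert n G v (Sym2.mem_mk_right i j) he,
    fPotential, sum_filter_subset_insert G _ he, fPotential, ← Finset.mul_sum, ← Finset.mul_sum]
  ring

/-- Detailed balance for the logistic link-updating dynamics. With the
Gibbs distribution `π(g) = exp(f(g))/Σ_{g'} exp(f(g'))` (sum over all graphs on `V`,
i.e. all sets of unordered pairs of distinct vertices), for any graph `h` with
`{i,j} ∉ h`, letting `g⁺ = h ∪ {{i,j}}`, `g⁻ = h`, `U⁺ = u_i(g⁺)+u_j(g⁺)`,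
`U⁻ = u_i(g⁻)+u_j(g⁻)`, and any recognition probability `p ≥ 0`:
`π(g⁻)·p·e^{U⁺}/(e^{U⁺}+e^{U⁻}) = π(g⁺)·p·e^{U⁻}/(e^{U⁺}+e^{U⁻})`, so `π` is
reversible (hence stationary) for the induced Markov chain. -/
theorem stmt_17 (n : ℕ) (G : Finset (Finset (Sym2 (Fin n))))
    (hG : ∀ h ∈ G, h.Nonempty ∧ ∀ e ∈ h, ¬ e.IsDiag)
    (v : Finset (Sym2 (Fin n)) → ℝ)
    (π : Finset (Sym2 (Fin n)) → ℝ)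
    (hπ : ∀ g, π g = Real.exp (fPotential n G v g) /
      ∑ g' ∈ (Finset.univ.filter (fun e : Sym2 (Fin n) => ¬ e.IsDiag)).powerset,
        Real.exp (fPotential n G v g'))
    (h : Finset (Sym2 (Fin n))) (hh : ∀ e ∈ h, ¬ e.IsDiag)
    (i j : Fin n) (hij : i ≠ j) (hnot : s(i, j) ∉ h)
    (p : ℝ) (hp : 0 ≤ p)
    (Uplus Uminus : ℝ)
    (hUplus : Uplus = uGraph n G v i (insert s(i, j) h) + uGraph n G v j (insert s(i, j) h))
    (hUminus : Uminus = uGraph n G v i h + uGraph n G v j h) :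
    π h * p * (Real.exp Uplus / (Real.exp Uplus + Real.exp Uminus)) =
      π (insert s(i, j) h) * p *
        (Real.exp Uminus / (Real.exp Uplus + Real.exp Uminus)) := by
  have key : Real.exp (fPotential n G v h) * Real.exp Uplus =
      Real.exp (fPotential n G v (insert s(i, j) h)) * Real.exp Uminus := by
    rw [← Real.exp_add, ← Real.exp_add, hUplus, hUminus, fPotential_insert_add n G v i j hnot]
  rw [hπ, hπ]
  simp only [div_eq_mul_inv]
  linear_combination (∑ g' ∈ (Finset.univ.filter (fun e : Sym2 (Fin n) => ¬ e.IsDiag)).powerset,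
    Real.exp (fPotential n G v g'))⁻¹ * p * (Real.exp Uplus + Real.exp Uminus)⁻¹ * key
end

section
/- Consider the links-and-triangles SUGM on n nodes with parameters p_T^n, p_L^n ∈ (0,1): for each 3-element subset T of {1,…,n}, an independent Bernoulli(p_T^n) indicator Y_T, and for each 2-element subset e, an independent Bernoulli(p_L^n) indicator Z_e, all mutually independent; the random graph g has edge e if and only if Z_e = 1 or Y_T = 1 for some triple T containing e. Let S_T(g) denote the number of 3-cliques (triangles) of g. Assume relative sparsity and growth: n^{3/2}·p_T^n → 0, n^{1/2}·p_L^n → 0, (p_L^n)³ / p_T^n → 0, and binom(n,3)·p_T^n → ∞ as n → ∞. Then the direct count estimator p̂_T^n = S_T(g) / binom(n,3) is ratio consistent: S_T(g) / (binom(n,3)·p_T^n) → 1 in probability. -/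
open Filter

/-- The 3-element subsets of `{1,…,n}` (potential triangles). -/
abbrev Triples (n : ℕ) : Finset (Finset (Fin n)) :=
  (Finset.univ : Finset (Fin n)).powersetCard 3

/-- The 2-element subsets of `{1,…,n}` (potential links). -/
abbrev Pairs (n : ℕ) : Finset (Finset (Fin n)) :=
  (Finset.univ : Finset (Fin n)).powersetCard 2

/-- Sample space of the links-and-triangles SUGM: a Bernoulli indicator for each
potential triangle and each potential link. -/
abbrev SugmOmega (n : ℕ) : Type :=
  (↥(Triples n) → Bool) × (↥(Pairs n) → Bool)

/-- Probability weight of an outcome: all triangle indicators are independent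
Bernoulli(`pT`) and all link indicators independent Bernoulli(`pL`),
all mutually independent. -/
noncomputable def sugmWt (n : ℕ) (pT pL : ℝ) (ω : SugmOmega n) : ℝ :=
  (∏ T : ↥(Triples n), if ω.1 T then pT else 1 - pT) *
    ∏ e : ↥(Pairs n), if ω.2 e then pL else 1 - pL

/-- The observed graph `g` has edge `e` iff the link indicator of `e` is on or some
truly generated triangle contains `e`. -/
def sugmEdge (n : ℕ) (ω : SugmOmega n) (e : ↥(Pairs n)) : Prop :=
  ω.2 e = true ∨ ∃ T : ↥(Triples n),
    ω.1 T = true ∧ (e : Finset (Fin n)) ⊆ (T : Finset (Fin n))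

/-- A triple of vertices is a 3-clique of the observed graph iff all pairs of its
vertices are edges of the observed graph. -/
def sugmTriangle (n : ℕ) (ω : SugmOmega n) (T : ↥(Triples n)) : Prop :=
  ∀ e : ↥(Pairs n), (e : Finset (Fin n)) ⊆ (T : Finset (Fin n)) → sugmEdge n ω e

open scoped Classical in
/-- `S_T(g)`: the number of 3-cliques (triangles) of the observed graph. -/
noncomputable def cliqueCount (n : ℕ) (ω : SugmOmega n) : ℕ :=
  (Finset.univ.filter (fun T : ↥(Triples n) => sugmTriangle n ω T)).card

open Finset in
/-- The product Bernoulli weights integrate a product of distinct coordinates to the product of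
the parameters. -/
theorem sum_bernoulli_weight_mul_prod {ι : Type*} [Fintype ι] [DecidableEq ι] (p : ι → ℝ)
    (S : Finset ι) :
    ∑ ω : ι → Bool, (∏ i, if ω i then p i else 1 - p i) * ∏ i ∈ S, (if ω i then (1 : ℝ) else 0)
      = ∏ i ∈ S, p i := by
  let f : ι → Bool → ℝ := fun i b =>
    (if b then p i else 1 - p i) * if i ∈ S then (if b then 1 else 0) else 1
  have key : ∀ ω : ι → Bool,
      (∏ i, if ω i then p i else 1 - p i) * ∏ i ∈ S, (if ω i then (1 : ℝ) else 0)
        = ∏ i, f i (ω i) := by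
    intro ω
    rw [prod_mul_distrib, Fintype.prod_ite_mem]
  rw [sum_congr rfl fun ω _ => key ω, ← Fintype.prod_sum f, ← Fintype.prod_ite_mem S p]
  refine prod_congr rfl fun i _ => ?_
  by_cases h : i ∈ S <;> simp [f, h]

/-- The indicator of a potential triangle or link being truly generated. -/
noncomputable def sugmInd {n : ℕ} (i : ↥(Triples n) ⊕ ↥(Pairs n)) (ω : SugmOmega n) : ℝ :=
  if Sum.elim ω.1 ω.2 i then 1 else 0

/-- The probability of a potential triangle or link being truly generated. -/
noncomputable def sugmProb {n : ℕ} (pT pL : ℝ) (i : ↥(Triples n) ⊕ ↥(Pairs n)) : ℝ :=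
  Sum.elim (fun _ => pT) (fun _ => pL) i

theorem sum_sugmWt_mul_prod (n : ℕ) (pT pL : ℝ) (S : Finset (↥(Triples n) ⊕ ↥(Pairs n))) :
    ∑ ω, sugmWt n pT pL ω * ∏ i ∈ S, sugmInd i ω = ∏ i ∈ S, sugmProb pT pL i := by
  rw [← sum_bernoulli_weight_mul_prod]
  refine (Fintype.sum_equiv (Equiv.sumArrowEquivProdArrow _ _ _) _ _ fun ω => ?_).symm
  congr 1
  · rw [Fintype.prod_sum_type]
    rfl
  · refine Finset.prod_congr rfl fun i _ => ?_
    rcases i with i | i <;> rfl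

theorem sum_sugmWt (n : ℕ) (pT pL : ℝ) : ∑ ω, sugmWt n pT pL ω = 1 := by
  simpa using sum_sugmWt_mul_prod n pT pL ∅

theorem sum_sugmWt_mul_sugmInd (n : ℕ) (pT pL : ℝ) (i : ↥(Triples n) ⊕ ↥(Pairs n)) :
    ∑ ω, sugmWt n pT pL ω * sugmInd i ω = sugmProb pT pL i := by
  simpa using sum_sugmWt_mul_prod n pT pL {i}

theorem sugmWt_nonneg {n : ℕ} {pT pL : ℝ} (hT : pT ∈ Set.Ioo (0 : ℝ) 1)
    (hL : pL ∈ Set.Ioo (0 : ℝ) 1) (ω : SugmOmega n) : 0 ≤ sugmWt n pT pL ω := by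
  refine mul_nonneg (Finset.prod_nonneg fun i _ => ?_) (Finset.prod_nonneg fun i _ => ?_)
  · split_ifs
    · exact hT.1.le
    · linarith [hT.2]
  · split_ifs
    · exact hL.1.le
    · linarith [hL.2]

theorem sugmInd_nonneg {n : ℕ} (i : ↥(Triples n) ⊕ ↥(Pairs n)) (ω : SugmOmega n) :
    0 ≤ sugmInd i ω := by
  unfold sugmInd
  split_ifs <;> norm_num

theorem sugmInd_mul_self {n : ℕ} (i : ↥(Triples n) ⊕ ↥(Pairs n)) (ω : SugmOmega n) :
    sugmInd i ω * sugmInd i ω = sugmInd i ω := by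
  unfold sugmInd
  split_ifs <;> norm_num

/-- Sums of indicators over disjoint index sets are independent. -/
theorem sum_sugmWt_mul_prod_sum {n : ℕ} (pT pL : ℝ) {κ : Type*} [Fintype κ]
    (A : κ → Finset (↥(Triples n) ⊕ ↥(Pairs n)))
    (hA : ∀ i j k, k ∈ A i → k ∈ A j → i = j) :
    ∑ ω, sugmWt n pT pL ω * ∏ k, ∑ i ∈ A k, sugmInd i ω = ∏ k, ∑ i ∈ A k, sugmProb pT pL i := by
  classical
  simp_rw [Finset.prod_univ_sum, Finset.mul_sum]
  rw [Finset.sum_comm]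
  refine Finset.sum_congr rfl fun s hs => ?_
  rw [Fintype.mem_piFinset] at hs
  have hinj : Function.Injective s := fun i j hij => hA i j (s i) (hs i) (hij ▸ hs j)
  have h := sum_sugmWt_mul_prod n pT pL (Finset.univ.image s)
  simpa only [Finset.prod_image hinj.injOn] using h

/-- The number of truly generated triangles. -/
noncomputable def trueCount {n : ℕ} (ω : SugmOmega n) : ℝ :=
  ∑ T : ↥(Triples n), sugmInd (Sum.inl T) ω

theorem card_triples (n : ℕ) : Fintype.card ↥(Triples n) = n.choose 3 := by
  simp [Triples]

theorem sum_sugmWt_mul_trueCount (n : ℕ) (pT pL : ℝ) :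
    ∑ ω : SugmOmega n, sugmWt n pT pL ω * trueCount ω = (n.choose 3 : ℝ) * pT := by
  simp_rw [trueCount, Finset.mul_sum]
  rw [Finset.sum_comm]
  simp_rw [sum_sugmWt_mul_sugmInd]
  simp only [sugmProb, Sum.elim_inl, Finset.sum_const, nsmul_eq_mul, Finset.card_univ,
    card_triples]

theorem sum_sugmWt_mul_trueCount_sq_le (n : ℕ) (pT pL : ℝ) :
    ∑ ω : SugmOmega n, sugmWt n pT pL ω * trueCount ω ^ 2
      ≤ (n.choose 3 : ℝ) * pT + ((n.choose 3 : ℝ) * pT) ^ 2 := by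
  have hpair : ∀ T T' : ↥(Triples n),
      ∑ ω, sugmWt n pT pL ω * (sugmInd (Sum.inl T) ω * sugmInd (Sum.inl T') ω)
        ≤ (if T = T' then pT else 0) + pT ^ 2 := by
    intro T T'
    split_ifs with h
    · subst h
      simp_rw [sugmInd_mul_self, sum_sugmWt_mul_sugmInd]
      simp only [sugmProb, Sum.elim_inl]
      nlinarith
    · have h' : (Sum.inl T : ↥(Triples n) ⊕ ↥(Pairs n)) ≠ Sum.inl T' := by simpa using h
      have := sum_sugmWt_mul_prod n pT pL {Sum.inl T, Sum.inl T'}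
      simp_rw [Finset.prod_pair h'] at this
      rw [this]
      simp only [sugmProb, Sum.elim_inl]
      nlinarith
  calc ∑ ω : SugmOmega n, sugmWt n pT pL ω * trueCount ω ^ 2
      = ∑ T : ↥(Triples n), ∑ T' : ↥(Triples n),
          ∑ ω, sugmWt n pT pL ω * (sugmInd (Sum.inl T) ω * sugmInd (Sum.inl T') ω) := by
        simp_rw [trueCount, sq, Finset.sum_mul_sum, Finset.mul_sum]
        rw [Finset.sum_comm]
        exact Finset.sum_congr rfl fun T _ => Finset.sum_comm
    _ ≤ ∑ T : ↥(Triples n), ∑ T' : ↥(Triples n), ((if T = T' then pT else 0) + pT ^ 2) :=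
        Finset.sum_le_sum fun T _ => Finset.sum_le_sum fun T' _ => hpair T T'
    _ = (n.choose 3 : ℝ) * pT + ((n.choose 3 : ℝ) * pT) ^ 2 := by
        simp only [Finset.sum_add_distrib, Finset.sum_ite_eq, Finset.mem_univ, if_true,
          Finset.sum_const, nsmul_eq_mul, Finset.card_univ, card_triples]
        ring

/-- The variance bound for the number of truly generated triangles. -/
theorem sum_sugmWt_mul_trueCount_sub_sq_le (n : ℕ) (pT pL : ℝ) :
    ∑ ω : SugmOmega n, sugmWt n pT pL ω * (trueCount ω - (n.choose 3 : ℝ) * pT) ^ 2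
      ≤ (n.choose 3 : ℝ) * pT := by
  set m : ℝ := (n.choose 3 : ℝ) * pT with hm
  have hexp : ∑ ω : SugmOmega n, sugmWt n pT pL ω * (trueCount ω - m) ^ 2
      = ∑ ω : SugmOmega n, sugmWt n pT pL ω * trueCount ω ^ 2
        - 2 * m * ∑ ω : SugmOmega n, sugmWt n pT pL ω * trueCount ω
        + m ^ 2 * ∑ ω : SugmOmega n, sugmWt n pT pL ω := by
    rw [Finset.mul_sum, Finset.mul_sum, ← Finset.sum_sub_distrib, ← Finset.sum_add_distrib]
    exact Finset.sum_congr rfl fun ω _ => by ring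
  rw [hexp, sum_sugmWt_mul_trueCount, sum_sugmWt]
  have := sum_sugmWt_mul_trueCount_sq_le n pT pL
  rw [← hm] at this ⊢
  nlinarith

/-- The subgraphs other than `T` itself that can generate the link `e` of `T`. -/
def edgeSources {n : ℕ} (T : ↥(Triples n)) (e : ↥(Pairs n)) :
    Finset (↥(Triples n) ⊕ ↥(Pairs n)) :=
  (Finset.univ.filter fun T' : ↥(Triples n) => (e : Finset (Fin n)) ⊆ T' ∧ T' ≠ T).disjSum {e}

theorem edgeSources_disjoint {n : ℕ} {T : ↥(Triples n)} {e e' : ↥(Pairs n)}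
    (he : (e : Finset (Fin n)) ⊆ T) (he' : (e' : Finset (Fin n)) ⊆ T)
    {k : ↥(Triples n) ⊕ ↥(Pairs n)} (hk : k ∈ edgeSources T e) (hk' : k ∈ edgeSources T e') :
    e = e' := by
  rcases k with T' | f
  · simp only [edgeSources, Finset.inl_mem_disjSum, Finset.mem_filter, Finset.mem_univ,
      true_and] at hk hk'
    have hT := (Finset.mem_powersetCard.1 T.2).2
    have hT' := (Finset.mem_powersetCard.1 T'.2).2
    have hlt : ((T : Finset (Fin n)) ∩ T').card < 3 := by
      refine lt_of_le_of_ne (hT ▸ Finset.card_le_card Finset.inter_subset_left) fun h => hk.2 ?_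
      have h1 := Finset.eq_of_subset_of_card_le
        (Finset.inter_subset_left (s₁ := (T : Finset (Fin n))) (s₂ := (T' : Finset (Fin n))))
        (by rw [h, hT])
      have h2 := Finset.eq_of_subset_of_card_le
        (Finset.inter_subset_right (s₁ := (T : Finset (Fin n))) (s₂ := (T' : Finset (Fin n))))
        (by rw [h, hT'])
      exact Subtype.ext (h2.symm.trans h1)
    have hinter : ∀ f : ↥(Pairs n), (f : Finset (Fin n)) ⊆ T → (f : Finset (Fin n)) ⊆ T' →
        (f : Finset (Fin n)) = (T : Finset (Fin n)) ∩ T' := by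
      intro f h1 h2
      refine Finset.eq_of_subset_of_card_le (Finset.subset_inter h1 h2) ?_
      rw [(Finset.mem_powersetCard.1 f.2).2]
      omega
    exact Subtype.ext ((hinter e he hk.1).trans (hinter e' he' hk'.1).symm)
  · simp only [edgeSources, Finset.inr_mem_disjSum, Finset.mem_singleton] at hk hk'
    exact hk.symm.trans hk'

theorem card_triples_containing_pair_le {n : ℕ} (e : ↥(Pairs n)) :
    (Finset.univ.filter fun T' : ↥(Triples n) => (e : Finset (Fin n)) ⊆ T').card ≤ n := by
  have hsub : (Finset.univ.filter fun T' : ↥(Triples n) => (e : Finset (Fin n)) ⊆ T').map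
      (Function.Embedding.subtype _) ⊆
        (Finset.univ : Finset (Fin n)).image fun v => insert v (e : Finset (Fin n)) := by
    intro U hU
    simp only [Finset.mem_map, Finset.mem_filter, Finset.mem_univ, true_and,
      Function.Embedding.subtype_apply] at hU
    obtain ⟨T', hT', rfl⟩ := hU
    have he := (Finset.mem_powersetCard.1 e.2).2
    have hc := (Finset.mem_powersetCard.1 T'.2).2
    obtain ⟨v, -, hv⟩ := (Finset.covBy_iff_exists_insert.1
      (Finset.covBy_iff_card_sdiff_eq_one.2 ⟨hT', by
        rw [Finset.card_sdiff_of_subset hT', he, hc]⟩))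
    exact Finset.mem_image.2 ⟨v, Finset.mem_univ _, hv⟩
  simpa using (Finset.card_le_card hsub).trans Finset.card_image_le

theorem sum_sugmProb_edgeSources_le {n : ℕ} {pT pL : ℝ} (hT : 0 ≤ pT) (T : ↥(Triples n))
    (e : ↥(Pairs n)) : ∑ i ∈ edgeSources T e, sugmProb pT pL i ≤ n * pT + pL := by
  rw [edgeSources, Finset.sum_disjSum]
  simp only [sugmProb, Sum.elim_inl, Sum.elim_inr, Finset.sum_const, nsmul_eq_mul,
    Finset.card_singleton, Nat.cast_one, one_mul]
  gcongr
  refine (Finset.card_le_card ?_).trans (card_triples_containing_pair_le e)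
  exact Finset.monotone_filter_right _ fun _ _ h => h.1

/-- An upper bound for the indicator that `T` is incidentally generated. -/
noncomputable def incidental {n : ℕ} (T : ↥(Triples n)) (ω : SugmOmega n) : ℝ :=
  ∏ e : {e : ↥(Pairs n) // (e : Finset (Fin n)) ⊆ T}, ∑ i ∈ edgeSources T e, sugmInd i ω

theorem incidental_nonneg {n : ℕ} (T : ↥(Triples n)) (ω : SugmOmega n) : 0 ≤ incidental T ω :=
  Finset.prod_nonneg fun _ _ => Finset.sum_nonneg fun i _ => sugmInd_nonneg i ω

theorem card_pairs_in_triple {n : ℕ} (T : ↥(Triples n)) :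
    Fintype.card {e : ↥(Pairs n) // (e : Finset (Fin n)) ⊆ T} = 3 := by
  have hT := (Finset.mem_powersetCard.1 T.2).2
  have h : (Finset.powersetCard 2 (T : Finset (Fin n))).card = 3 := by
    rw [Finset.card_powersetCard, hT]
    rfl
  rw [← h, ← Fintype.card_coe]
  refine Fintype.card_congr
    { toFun := fun e => ⟨e.1.1, Finset.mem_powersetCard.2
        ⟨e.2, (Finset.mem_powersetCard.1 e.1.2).2⟩⟩
      invFun := fun e => ⟨⟨e.1, Finset.mem_powersetCard.2
        ⟨Finset.subset_univ _, (Finset.mem_powersetCard.1 e.2).2⟩⟩,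
          (Finset.mem_powersetCard.1 e.2).1⟩
      left_inv := fun _ => rfl
      right_inv := fun _ => rfl }

theorem sum_sugmWt_mul_incidental_le {n : ℕ} {pT pL : ℝ} (hT : 0 ≤ pT) (hL : 0 ≤ pL)
    (T : ↥(Triples n)) :
    ∑ ω, sugmWt n pT pL ω * incidental T ω ≤ (n * pT + pL) ^ 3 := by
  unfold incidental
  rw [sum_sugmWt_mul_prod_sum pT pL
    (fun e : {e : ↥(Pairs n) // (e : Finset (Fin n)) ⊆ T} => edgeSources T e)
    fun i j k hi hj => Subtype.ext (edgeSources_disjoint i.2 j.2 hi hj)]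
  refine (Finset.prod_le_prod (g := fun _ => n * pT + pL) ?_ ?_).trans_eq ?_
  · intro e _
    refine Finset.sum_nonneg fun i _ => ?_
    rcases i with i | i <;> simpa [sugmProb]
  · exact fun e _ => sum_sugmProb_edgeSources_le hT T e
  · rw [Finset.prod_const, Finset.card_univ, card_pairs_in_triple]

theorem sugmInd_le_ite_sugmTriangle {n : ℕ} (T : ↥(Triples n)) (ω : SugmOmega n)
    [Decidable (sugmTriangle n ω T)] :
    sugmInd (Sum.inl T) ω ≤ if sugmTriangle n ω T then 1 else 0 := by
  unfold sugmInd
  by_cases h : ω.1 T = true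
  · have : sugmTriangle n ω T := fun e he => Or.inr ⟨T, h, he⟩
    simp [h, this]
  · simp only [Sum.elim_inl, h, Bool.false_eq_true, if_false]
    split_ifs <;> norm_num

theorem ite_sugmTriangle_le {n : ℕ} (T : ↥(Triples n)) (ω : SugmOmega n)
    [Decidable (sugmTriangle n ω T)] :
    (if sugmTriangle n ω T then 1 else 0) ≤ sugmInd (Sum.inl T) ω + incidental T ω := by
  have h0 := sugmInd_nonneg (Sum.inl T) ω
  have h1 := incidental_nonneg T ω
  split_ifs with htri
  · by_cases h : ω.1 T = true
    · have : sugmInd (Sum.inl T) ω = 1 := by simp [sugmInd, h]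
      linarith
    · refine le_add_of_nonneg_of_le h0 ?_
      have hone : ∀ e : {e : ↥(Pairs n) // (e : Finset (Fin n)) ⊆ T},
          1 ≤ ∑ i ∈ edgeSources T e, sugmInd i ω := by
        intro e
        have hex : ∃ i ∈ edgeSources T e, sugmInd i ω = 1 := by
          rcases htri e e.2 with hl | ⟨T', hT', hsub⟩
          · exact ⟨Sum.inr e, by simp [edgeSources], by simp [sugmInd, hl]⟩
          · refine ⟨Sum.inl T', ?_, by simp [sugmInd, hT']⟩
            simp only [edgeSources, Finset.inl_mem_disjSum, Finset.mem_filter, Finset.mem_univ,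
              true_and]
            exact ⟨hsub, fun h' => h (h' ▸ hT')⟩
        obtain ⟨i, hi, hi1⟩ := hex
        rw [← hi1]
        exact Finset.single_le_sum (fun j _ => sugmInd_nonneg j ω) hi
      exact Finset.one_le_prod fun e _ => hone e
  · linarith

theorem trueCount_le_cliqueCount {n : ℕ} (ω : SugmOmega n) :
    trueCount ω ≤ (cliqueCount n ω : ℝ) := by
  classical
  rw [cliqueCount, Finset.card_filter]
  push_cast
  exact Finset.sum_le_sum fun T _ => sugmInd_le_ite_sugmTriangle T ω

theorem cliqueCount_le {n : ℕ} (ω : SugmOmega n) :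
    (cliqueCount n ω : ℝ) ≤ trueCount ω + ∑ T : ↥(Triples n), incidental T ω := by
  classical
  rw [cliqueCount, Finset.card_filter, trueCount, ← Finset.sum_add_distrib]
  push_cast
  exact Finset.sum_le_sum fun T _ => ite_sugmTriangle_le T ω

/-- A deviation of `s` from `m` comes from a deviation of `b` or from a large difference `s - b`. -/
theorem one_le_of_lt_abs_div_sub_one {s b d m ε : ℝ} (hm : 0 < m) (hε : 0 < ε) (hbs : b ≤ s)
    (hsb : s ≤ b + d) (h : ε < |s / m - 1|) :
    1 ≤ 4 / (ε * m) ^ 2 * (b - m) ^ 2 + 2 / (ε * m) * d := by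
  have hδ : 0 < ε * m := mul_pos hε hm
  have hd : 0 ≤ d := by linarith
  have h' : ε * m < |s - m| := by
    have : s / m - 1 = (s - m) / m := by field_simp
    rwa [this, abs_div, abs_of_pos hm, lt_div_iff₀ hm] at h
  have ha : 0 ≤ 4 / (ε * m) ^ 2 * (b - m) ^ 2 := by positivity
  have hb : 0 ≤ 2 / (ε * m) * d := by positivity
  by_cases hbig : ε * m ≤ 2 * d
  · have : 1 ≤ 2 / (ε * m) * d := by
      rw [div_mul_eq_mul_div, le_div_iff₀ hδ]
      linarith
    linarith
  · have hdev : ε * m / 2 ≤ |b - m| := by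
      have htri : |s - m| ≤ |s - b| + |b - m| := abs_sub_le s b m
      rw [abs_of_nonneg (sub_nonneg.2 hbs)] at htri
      linarith
    have : 1 ≤ 4 / (ε * m) ^ 2 * (b - m) ^ 2 := by
      rw [div_mul_eq_mul_div, le_div_iff₀ (by positivity), ← sq_abs (b - m)]
      nlinarith
    linarith

theorem sugm_deviation_le {n : ℕ} {pT pL ε : ℝ} (hT : pT ∈ Set.Ioo (0 : ℝ) 1)
    (hL : pL ∈ Set.Ioo (0 : ℝ) 1) (hε : 0 < ε) (hm : 0 < (n.choose 3 : ℝ) * pT) :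
    ∑ ω : SugmOmega n, Set.indicator {ω' : SugmOmega n |
        ε < |(cliqueCount n ω' : ℝ) / ((n.choose 3 : ℝ) * pT) - 1|} (sugmWt n pT pL) ω
      ≤ 4 / ε ^ 2 * ((n.choose 3 : ℝ) * pT)⁻¹ + 2 / ε * ((n * pT + pL) ^ 3 / pT) := by
  have hN : (0 : ℝ) < n.choose 3 := pos_of_mul_pos_left hm hT.1.le
  have hpos := hT.1
  set m : ℝ := (n.choose 3 : ℝ) * pT with hmdef
  have hI : ∑ ω, sugmWt n pT pL ω * ∑ T : ↥(Triples n), incidental T ω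
      ≤ (n.choose 3 : ℝ) * (n * pT + pL) ^ 3 := by
    simp_rw [Finset.mul_sum]
    rw [Finset.sum_comm]
    refine (Finset.sum_le_sum fun T _ =>
      sum_sugmWt_mul_incidental_le hT.1.le hL.1.le T).trans_eq ?_
    rw [Finset.sum_const, nsmul_eq_mul, Finset.card_univ, card_triples]
  calc _ ≤ ∑ ω : SugmOmega n, (4 / (ε * m) ^ 2 * (sugmWt n pT pL ω * (trueCount ω - m) ^ 2)
          + 2 / (ε * m) * (sugmWt n pT pL ω * ∑ T : ↥(Triples n), incidental T ω)) := by
        refine Finset.sum_le_sum fun ω _ => ?_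
        refine Set.indicator_le' (s := {ω' : SugmOmega n |
          ε < |(cliqueCount n ω' : ℝ) / m - 1|}) (f := sugmWt n pT pL)
          (g := fun ω : SugmOmega n =>
            4 / (ε * m) ^ 2 * (sugmWt n pT pL ω * (trueCount ω - m) ^ 2)
              + 2 / (ε * m) * (sugmWt n pT pL ω * ∑ T : ↥(Triples n), incidental T ω))
          (fun ω h => ?_) (fun ω _ => ?_) ω
        · have h1 := one_le_of_lt_abs_div_sub_one hm hε (trueCount_le_cliqueCount ω)
            (cliqueCount_le ω) h
          have h2 := mul_le_mul_of_nonneg_left h1 (sugmWt_nonneg hT hL ω)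
          linarith
        · have hw := sugmWt_nonneg hT hL ω
          have hd : 0 ≤ ∑ T : ↥(Triples n), incidental T ω :=
            Finset.sum_nonneg fun T _ => incidental_nonneg T ω
          positivity
    _ ≤ 4 / (ε * m) ^ 2 * m + 2 / (ε * m) * ((n.choose 3 : ℝ) * (n * pT + pL) ^ 3) := by
        rw [Finset.sum_add_distrib, ← Finset.mul_sum, ← Finset.mul_sum]
        gcongr
        exact sum_sugmWt_mul_trueCount_sub_sq_le n pT pL
    _ = 4 / ε ^ 2 * m⁻¹ + 2 / ε * ((n * pT + pL) ^ 3 / pT) := by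
        rw [hmdef]
        field_simp

theorem tendsto_incidental_rate {pT pL : ℕ → ℝ} (hpT : ∀ n, 0 < pT n) (hpL : ∀ n, 0 < pL n)
    (h1 : Tendsto (fun n : ℕ => (n : ℝ) ^ ((3 : ℝ) / 2) * pT n) atTop (nhds 0))
    (h3 : Tendsto (fun n : ℕ => pL n ^ 3 / pT n) atTop (nhds 0)) :
    Tendsto (fun n : ℕ => (n * pT n + pL n) ^ 3 / pT n) atTop (nhds 0) := by
  have hlim : Tendsto (fun n : ℕ => 4 * (((n : ℝ) ^ ((3 : ℝ) / 2) * pT n) ^ 2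
      + pL n ^ 3 / pT n)) atTop (nhds 0) := by
    simpa using ((h1.pow 2).add h3).const_mul 4
  refine squeeze_zero (fun n => ?_) (fun n => ?_) hlim
  · have := hpT n
    have := hpL n
    positivity
  · have hp := hpT n
    have hq := hpL n
    have hpow : ((n : ℝ) ^ ((3 : ℝ) / 2)) ^ 2 = (n : ℝ) ^ 3 := by
      rw [← Real.rpow_natCast, ← Real.rpow_mul n.cast_nonneg, ← Real.rpow_natCast]
      norm_num
    have hcube := add_pow_le (by positivity : 0 ≤ (n : ℝ) * pT n) hq.le 3
    rw [div_le_iff₀ hp, mul_pow, hpow]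
    refine hcube.trans_eq ?_
    field_simp
    norm_num

/-- In the links-and-triangles SUGM, under relative sparsity and
growth (`n^{3/2} p_T^n → 0`, `n^{1/2} p_L^n → 0`, `(p_L^n)³/p_T^n → 0`,
`binom(n,3)·p_T^n → ∞`), the direct count estimator `p̂_T^n = S_T(g)/binom(n,3)` is
ratio consistent: `S_T(g)/(binom(n,3)·p_T^n) → 1` in probability. -/
theorem stmt_18 (pT pL : ℕ → ℝ)
    (hpT : ∀ n, pT n ∈ Set.Ioo (0 : ℝ) 1) (hpL : ∀ n, pL n ∈ Set.Ioo (0 : ℝ) 1)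
    (h1 : Tendsto (fun n : ℕ => (n : ℝ) ^ ((3 : ℝ) / 2) * pT n) atTop (nhds 0))
    (h2 : Tendsto (fun n : ℕ => (n : ℝ) ^ ((1 : ℝ) / 2) * pL n) atTop (nhds 0))
    (h3 : Tendsto (fun n : ℕ => pL n ^ 3 / pT n) atTop (nhds 0))
    (h4 : Tendsto (fun n : ℕ => (n.choose 3 : ℝ) * pT n) atTop atTop) :
    ∀ ε : ℝ, 0 < ε →
      Tendsto (fun n : ℕ => ∑ ω : SugmOmega n,
          Set.indicator {ω' : SugmOmega n |
              ε < |(cliqueCount n ω' : ℝ) / ((n.choose 3 : ℝ) * pT n) - 1|}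
            (sugmWt n (pT n) (pL n)) ω)
        atTop (nhds 0) := by
  intro ε hε
  have hlim : Tendsto (fun n : ℕ => 4 / ε ^ 2 * ((n.choose 3 : ℝ) * pT n)⁻¹
      + 2 / ε * ((n * pT n + pL n) ^ 3 / pT n)) atTop (nhds 0) := by
    simpa using (h4.inv_tendsto_atTop.const_mul (4 / ε ^ 2)).add
      ((tendsto_incidental_rate (fun n => (hpT n).1) (fun n => (hpL n).1) h1 h3).const_mul
        (2 / ε))
  refine squeeze_zero' (Eventually.of_forall fun n => ?_) ?_ hlim
  · exact Finset.sum_nonneg fun ω _ =>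
      Set.indicator_nonneg (fun ω _ => sugmWt_nonneg (hpT n) (hpL n) ω) ω
  · filter_upwards [h4.eventually_gt_atTop 0] with n hn
    exact sugm_deviation_le (hpT n) (hpL n) hε hn
end
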